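/- Bounds relating ε_n to the concentration function and a lower bound on ε_n (Lemma 3.2): Fix K > 0, let p ∈ [1,2], α, τ > 0, n ≥ 1, θ₀ ∈ ℓ₂, and let ε_n = ε_n(α,τ) be the unique solution of Π(θ : ‖θ−θ₀‖₂ ≤ Kε_n|α,τ) = e^{−nε_n²}. Then: (1) φ₀(Kε_n) ≤ nε_n² ≤ φ_{θ₀}(Kε_n/2), where φ_θ is the concentration function of Π(·|α,τ) at θ. (2) For any C̃ > 0 there exists c̃₁ = c̃₁(α,C̃) > 0 such that for all ε, τ > 0 with ε ≤ C̃τ, c̃₁^{−1}(Kε/τ)^{−1/α} ≤ φ₀(Kε) ≤ c̃₁(Kε/τ)^{−1/α}; moreover c̃₁ can be chosen uniformly over α in any bounded interval [α₁, α₂] with 0 < α₁ < α₂. (3) Consequently, provided ε_n ≤ C̃τ, one has nε_n² ≥ c̃₁^{−1}(K/τ)^{−1/α}ε_n^{−1/α} and ε_n ≥ (c̃₁^{−1}K^{−1/α})^{α/(1+2α)} τ^{1/(1+2α)} n^{−α/(1+2α)}. -/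

import Mathlib

noncomputable section

open MeasureTheory ProbabilityTheory Filter Set

/-- The index `ℓ = i + 1 ≥ 1` associated to the coordinate `i : ℕ`. -/
def idx (i : ℕ) : ℝ := (i : ℝ) + 1

/-- The `p`-exponential probability density on `ℝ`:
`f_p(x) = exp(−|x|^p/p) / (2 Γ(1/p) p^{1/p−1})`. -/
def pexpDensity (p x : ℝ) : ℝ :=
  Real.exp (-|x| ^ p / p) / (2 * Real.Gamma (1 / p) * p ^ (1 / p - 1))

/-- The `p`-exponential probability measure on `ℝ`. -/
def pexpMeasure (p : ℝ) : Measure ℝ :=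
  MeasureTheory.volume.withDensity fun x => ENNReal.ofReal (pexpDensity p x)

/-- The law of the `i`-th coordinate `τ ℓ^{−1/2−α} ξ` (with `ℓ = i+1`) of a draw from the
`α`-regular `τ`-scaled `p`-exponential prior. -/
def coordLaw (p α τ : ℝ) (i : ℕ) : Measure ℝ :=
  (pexpMeasure p).map fun x => τ * idx i ^ (-(1 / 2 : ℝ) - α) * x

/-- `μ` is the `α`-regular `τ`-scaled `p`-exponential prior on `ℝ^ℕ`: the joint law of the
independent coordinates `τ ℓ^{−1/2−α} ξ_ℓ` with `ξ_ℓ` i.i.d. `p`-exponential. -/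
def IsPexpPrior (p α τ : ℝ) (μ : Measure (ℕ → ℝ)) : Prop :=
  IsProbabilityMeasure μ ∧
  IsProjectiveLimit μ fun I : Finset ℕ => Measure.pi fun i : I => coordLaw p α τ i

/-- `μ` is the Gaussian sequence model measure `P^n_θ`: the joint law of independent
coordinates `X_ℓ ~ N(θ_ℓ, 1/n)`. -/
def IsGaussModel (n : ℕ) (θ : ℕ → ℝ) (μ : Measure (ℕ → ℝ)) : Prop :=
  IsProbabilityMeasure μ ∧
  IsProjectiveLimit μ fun I : Finset ℕ =>
    Measure.pi fun i : I => gaussianReal (θ i) ((n : NNReal))⁻¹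

/-- The `ℓ₂` norm of a sequence (with the `tsum` junk-value convention). -/
def l2norm (θ : ℕ → ℝ) : ℝ := Real.sqrt (∑' i, θ i ^ 2)

/-- Membership in the Sobolev ball `H^β(L)`. -/
def inSobolevBall (β L : ℝ) (θ : ℕ → ℝ) : Prop :=
  Summable (fun i => idx i ^ (2 * β) * θ i ^ 2) ∧
    Real.sqrt (∑' i, idx i ^ (2 * β) * θ i ^ 2) ≤ L

/-- The log-likelihood `ℓ_n(θ) = n Σ_ℓ X_ℓ θ_ℓ − (n/2) ‖θ‖₂²` in the Gaussian sequence model. -/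
def loglik (n : ℕ) (θ X : ℕ → ℝ) : ℝ :=
  (n : ℝ) * (∑' i, X i * θ i) - (n : ℝ) / 2 * ∑' i, θ i ^ 2

/-- The likelihood ratio `p^n_θ(X) = dP^n_θ/dP^n_0 (X)`. -/
def lik (n : ℕ) (θ X : ℕ → ℝ) : ℝ := Real.exp (loglik n θ X)

/-- The marginal likelihood of the data `X` for the prior `prior`. -/
def marginalLik (n : ℕ) (prior : Measure (ℕ → ℝ)) (X : ℕ → ℝ) : ℝ :=
  ∫ θ, lik n θ X ∂prior

/-- The posterior mass of a set `B` given data `X`, for the prior `prior`. -/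
def post (n : ℕ) (prior : Measure (ℕ → ℝ)) (X : ℕ → ℝ) (B : Set (ℕ → ℝ)) : ℝ :=
  (∫ θ in B, lik n θ X ∂prior) / marginalLik n prior X

/-- The summand of the `Z_{α,τ}` (quasi-)norm: `ℓ^{p/2+αp} |h_ℓ|^p`. -/
def zSummand (p α : ℝ) (h : ℕ → ℝ) (i : ℕ) : ℝ := idx i ^ (p / 2 + α * p) * |h i| ^ p

/-- `‖h‖_{Z_{α,τ}}^p = τ^{−p} Σ_ℓ ℓ^{p/2+αp} |h_ℓ|^p`. -/
def zNormP (p α τ : ℝ) (h : ℕ → ℝ) : ℝ := τ ^ (-p) * ∑' i, zSummand p α h i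

/-- The centered `ℓ₂`-ball of radius `ε`. -/
def l2Ball (ε : ℝ) : Set (ℕ → ℝ) := {θ | Summable (fun i => θ i ^ 2) ∧ l2norm θ ≤ ε}

/-- The concentration function `φ_θ(ε)` of the prior `Pi = Π(·|α,τ)` at `θ`:
`inf{‖h‖_{Z_{α,τ}}^p : h ∈ Z_{α,τ}, ‖h−θ‖₂ ≤ ε} − log Π(ε B_{ℓ₂})`. -/
def concFun (p α τ : ℝ) (Pi : Measure (ℕ → ℝ)) (θ : ℕ → ℝ) (ε : ℝ) : ℝ :=
  sInf {c : ℝ | ∃ h : ℕ → ℝ, Summable (zSummand p α h) ∧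
      Summable (fun i => (h i - θ i) ^ 2) ∧ l2norm (fun i => h i - θ i) ≤ ε ∧
      c = zNormP p α τ h} -
    Real.log (Pi (l2Ball ε)).toReal

lemma abs_add_rpow_add_abs_sub_rpow_le {p : ℝ} (hp : p ∈ Set.Icc (1 : ℝ) 2) (x h : ℝ) :
    |x + h| ^ p + |x - h| ^ p ≤ 2 * |x| ^ p + 2 * |h| ^ p := by
  obtain ⟨h1, h2⟩ := hp
  have key : ∀ y : ℝ, |y| ^ p = (y ^ 2) ^ (p / 2) := by
    intro y
    rw [← sq_abs, ← Real.rpow_natCast, ← Real.rpow_mul (abs_nonneg y)]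
    congr 1
    push_cast
    ring
  simp only [key]
  have hcc := Real.concaveOn_rpow (p := p / 2) (by linarith) (by linarith)
  have hc := hcc.2 (mem_Ici.mpr (sq_nonneg (x + h))) (mem_Ici.mpr (sq_nonneg (x - h)))
    (by norm_num : (0 : ℝ) ≤ 1 / 2) (by norm_num : (0 : ℝ) ≤ 1 / 2) (by norm_num)
  simp only [smul_eq_mul] at hc
  have he : 1 / 2 * (x + h) ^ 2 + 1 / 2 * (x - h) ^ 2 = x ^ 2 + h ^ 2 := by ring
  rw [he] at hc
  have := Real.rpow_add_le_add_rpow (sq_nonneg x) (sq_nonneg h)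
    (p := p / 2) (by linarith) (by linarith)
  linarith

lemma pexpNorm_pos {p : ℝ} (hp : 1 ≤ p) : 0 < 2 * Real.Gamma (1 / p) * p ^ (1 / p - 1) := by
  have : 0 < p := by linarith
  have := Real.Gamma_pos_of_pos (one_div_pos.mpr this)
  positivity

lemma pexpDensity_pos {p : ℝ} (hp : 1 ≤ p) (x : ℝ) : 0 < pexpDensity p x :=
  div_pos (Real.exp_pos _) (pexpNorm_pos hp)

lemma measurable_pexpDensity (p : ℝ) : Measurable (pexpDensity p) := by
  unfold pexpDensity
  fun_prop

lemma measurable_ofReal_pexpDensity (p : ℝ) :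
    Measurable fun x => ENNReal.ofReal (pexpDensity p x) :=
  (measurable_pexpDensity p).ennreal_ofReal

lemma pexpDensity_neg (p x : ℝ) : pexpDensity p (-x) = pexpDensity p x := by
  simp [pexpDensity]

lemma pexpDensity_anti {p : ℝ} (hp : 1 ≤ p) {x y : ℝ} (h : |x| ≤ |y|) :
    pexpDensity p y ≤ pexpDensity p x := by
  unfold pexpDensity
  have := pexpNorm_pos hp
  have h' : |x| ^ p ≤ |y| ^ p := Real.rpow_le_rpow (abs_nonneg _) h (by linarith)
  gcongr

lemma integrable_of_even {f : ℝ → ℝ} (hf : IntegrableOn f (Ioi 0)) :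
    Integrable fun x => f |x| := by
  have e : IntegrableOn (fun x => f |x|) (Ioi 0) :=
    hf.congr_fun (fun x hx => by simp [abs_of_pos (mem_Ioi.mp hx)]) measurableSet_Ioi
  have e' : IntegrableOn (fun x => f |x|) (Iic 0) := by
    rw [← Measure.map_neg_eq_self (volume : Measure ℝ)]
    let m : MeasurableEmbedding fun x : ℝ => -x := (Homeomorph.neg ℝ).measurableEmbedding
    rw [m.integrableOn_map_iff]
    simp_rw [Function.comp_def, abs_neg, neg_preimage, neg_Iic, neg_zero]
    exact Iff.mpr integrableOn_Ici_iff_integrableOn_Ioi e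
  rw [← integrableOn_univ, ← Iic_union_Ioi (a := (0 : ℝ))]
  exact e'.union e

lemma integrable_sq_mul_pexpDensity {p : ℝ} (hp : 1 ≤ p) :
    Integrable fun x => x ^ 2 * pexpDensity p x := by
  have h0 : 0 < p := by linarith
  have h := integrableOn_rpow_mul_exp_neg_mul_rpow (p := p) (s := 2) (b := 1 / p)
    (by norm_num) h0 (by positivity)
  have := (integrable_of_even h).div_const (2 * Real.Gamma (1 / p) * p ^ (1 / p - 1))
  refine this.congr (Eventually.of_forall fun x => ?_)
  simp only [pexpDensity, Real.rpow_two, sq_abs]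
  rw [mul_div_assoc, neg_mul, one_div_mul_eq_div, neg_div]

lemma lintegral_pexpDensity {p : ℝ} (hp : 1 ≤ p) :
    ∫⁻ x, ENNReal.ofReal (pexpDensity p x) = 1 := by
  have h0 : 0 < p := by linarith
  have h := integrableOn_rpow_mul_exp_neg_mul_rpow (p := p) (s := 0) (b := 1 / p)
    (by norm_num) h0 (by positivity)
  have hi : Integrable (pexpDensity p) := by
    have := (integrable_of_even h).div_const (2 * Real.Gamma (1 / p) * p ^ (1 / p - 1))
    refine this.congr (Eventually.of_forall fun x => ?_)
    simp only [pexpDensity, Real.rpow_zero, one_mul]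
    congr 2
    ring
  rw [← ofReal_integral_eq_lintegral_ofReal hi
    (Eventually.of_forall fun x => (pexpDensity_pos hp x).le)]
  rw [← ENNReal.ofReal_one]
  congr 1
  have e : ∀ x, pexpDensity p x = (fun y => Real.exp (-(1 / p) * y ^ p) /
      (2 * Real.Gamma (1 / p) * p ^ (1 / p - 1))) |x| := by
    intro x
    simp only [pexpDensity]
    congr 2
    ring
  simp_rw [e]
  rw [integral_comp_abs (f := fun y => Real.exp (-(1 / p) * y ^ p) /
      (2 * Real.Gamma (1 / p) * p ^ (1 / p - 1))), integral_div,
    integral_exp_neg_mul_rpow h0 (by positivity), Real.Gamma_add_one (by positivity)]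
  have hG := Real.Gamma_pos_of_pos (one_div_pos.mpr h0)
  rw [one_div p, Real.inv_rpow h0.le, ← Real.rpow_neg h0.le, Real.rpow_sub_one h0.ne',
    show -(-1 / p) = p⁻¹ by ring]
  rw [one_div] at hG
  have : 0 < p ^ p⁻¹ := by positivity
  field_simp

lemma isProbabilityMeasure_pexpMeasure {p : ℝ} (hp : 1 ≤ p) :
    IsProbabilityMeasure (pexpMeasure p) :=
  ⟨by rw [pexpMeasure, withDensity_apply _ MeasurableSet.univ, setLIntegral_univ,
    lintegral_pexpDensity hp]⟩

lemma lintegral_sq_pexpMeasure_lt_top {p : ℝ} (hp : 1 ≤ p) :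
    ∫⁻ x, ENNReal.ofReal (x ^ 2) ∂pexpMeasure p < ⊤ := by
  rw [pexpMeasure, lintegral_withDensity_eq_lintegral_mul _ (measurable_ofReal_pexpDensity p)
    (by fun_prop)]
  refine lt_of_le_of_lt (lintegral_mono fun x => ?_)
    (integrable_sq_mul_pexpDensity hp).lintegral_lt_top
  rw [Pi.mul_apply, ← ENNReal.ofReal_mul (pexpDensity_pos hp x).le, mul_comm]

/-- Anderson's inequality in dimension one. -/
lemma pexpMeasure_abs_sub_le {p : ℝ} (hp : 1 ≤ p) (t s : ℝ) :
    pexpMeasure p {x | |x - t| ≤ s} ≤ pexpMeasure p {x | |x| ≤ s} := by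
  have := isProbabilityMeasure_pexpMeasure hp
  rcases lt_or_ge s 0 with hs | hs
  · have : {x : ℝ | |x - t| ≤ s} = ∅ := by
      ext x
      simp only [mem_ofPred_eq, mem_empty_iff_false, iff_false, not_le]
      exact hs.trans_le (abs_nonneg _)
    simp [this]
  have hJ : {x : ℝ | |x - t| ≤ s} = Icc (t - s) (t + s) := by
    ext x
    simp only [mem_ofPred_eq, abs_le, mem_Icc]
    constructor <;> rintro ⟨h1, h2⟩ <;> constructor <;> linarith
  have hI : {x : ℝ | |x| ≤ s} = Icc (-s) s := by
    ext x
    simp only [mem_ofPred_eq, abs_le, mem_Icc]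
  have hmJ : MeasurableSet {x : ℝ | |x - t| ≤ s} := hJ ▸ measurableSet_Icc
  have hmI : MeasurableSet {x : ℝ | |x| ≤ s} := hI ▸ measurableSet_Icc
  have hvol : volume ({x : ℝ | |x - t| ≤ s} \ {x | |x| ≤ s}) =
      volume ({x : ℝ | |x| ≤ s} \ {x | |x - t| ≤ s}) := by
    have e1 := measure_inter_add_sdiff (μ := volume) {x : ℝ | |x - t| ≤ s} hmI
    have e2 := measure_inter_add_sdiff (μ := volume) {x : ℝ | |x| ≤ s} hmJ
    have e3 : volume {x : ℝ | |x - t| ≤ s} = volume {x : ℝ | |x| ≤ s} := by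
      rw [hJ, hI, Real.volume_Icc, Real.volume_Icc]
      congr 1
      ring
    rw [e3, ← e2, inter_comm] at e1
    refine (ENNReal.add_right_inj (ne_top_of_le_ne_top ?_ (measure_mono inter_subset_left))).mp e1
    rw [hI, Real.volume_Icc]
    exact ENNReal.ofReal_ne_top
  rw [← measure_inter_add_sdiff {x : ℝ | |x - t| ≤ s} hmI,
    ← measure_inter_add_sdiff {x : ℝ | |x| ≤ s} hmJ, inter_comm]
  gcongr 1
  rw [pexpMeasure, withDensity_apply _ (hmJ.diff hmI), withDensity_apply _ (hmI.diff hmJ)]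
  calc ∫⁻ x in {x : ℝ | |x - t| ≤ s} \ {x | |x| ≤ s}, ENNReal.ofReal (pexpDensity p x)
      ≤ ∫⁻ x in {x : ℝ | |x - t| ≤ s} \ {x | |x| ≤ s}, ENNReal.ofReal (pexpDensity p s) := by
        refine setLIntegral_mono' (hmJ.diff hmI) fun x hx => ?_
        refine ENNReal.ofReal_le_ofReal (pexpDensity_anti hp ?_)
        rw [abs_of_nonneg hs]
        exact (not_le.mp hx.2).le
    _ = ∫⁻ x in {x : ℝ | |x| ≤ s} \ {x | |x - t| ≤ s}, ENNReal.ofReal (pexpDensity p s) := by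
        rw [setLIntegral_const, setLIntegral_const, hvol]
    _ ≤ _ := by
        refine setLIntegral_mono' (hmI.diff hmJ) fun x hx => ?_
        refine ENNReal.ofReal_le_ofReal (pexpDensity_anti hp ?_)
        rw [abs_of_nonneg hs]
        exact hx.1

lemma two_mul_exp_mul_pexpDensity_le {p : ℝ} (hp : p ∈ Set.Icc (1 : ℝ) 2) (x h : ℝ) :
    2 * (Real.exp (-|h| ^ p) * pexpDensity p x) ≤ pexpDensity p (x + h) + pexpDensity p (x - h) := by
  have hN := pexpNorm_pos hp.1
  have h0 : 0 < p := by linarith [hp.1]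
  simp only [pexpDensity]
  rw [← add_div, ← mul_div_assoc, ← mul_div_assoc, ← Real.exp_add]
  gcongr
  set a := -|x + h| ^ p / p
  set b := -|x - h| ^ p / p
  have h1 : 2 * Real.exp ((a + b) / 2) ≤ Real.exp a + Real.exp b := by
    have ea : Real.exp a = Real.exp (a / 2) ^ 2 := by rw [← Real.exp_nat_mul]; congr 1; push_cast; ring
    have eb : Real.exp b = Real.exp (b / 2) ^ 2 := by rw [← Real.exp_nat_mul]; congr 1; push_cast; ring
    rw [add_div, Real.exp_add, ea, eb]
    nlinarith [sq_nonneg (Real.exp (a / 2) - Real.exp (b / 2))]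
  refine le_trans ?_ h1
  gcongr
  have h2 := abs_add_rpow_add_abs_sub_rpow_le hp x h
  have h3 : 0 ≤ |h| ^ p := by positivity
  have h4 : |h| ^ p / p ≤ |h| ^ p := div_le_self h3 hp.1
  have h5 : (|x + h| ^ p + |x - h| ^ p) / p ≤ (2 * |x| ^ p + 2 * |h| ^ p) / p := by gcongr
  have e : a + b = -((|x + h| ^ p + |x - h| ^ p) / p) := by simp only [a, b]; ring
  rw [e]
  have e2 : (2 * |x| ^ p + 2 * |h| ^ p) / p = 2 * (|x| ^ p / p) + 2 * (|h| ^ p / p) := by ring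
  rw [e2] at h5
  have e3 : -|x| ^ p / p = -(|x| ^ p / p) := by ring
  rw [e3]
  linarith

lemma pexpMeasure_abs_sub_eq (p t s : ℝ) :
    pexpMeasure p {x | |x - t| ≤ s} =
      ∫⁻ x in {x | |x| ≤ s}, ENNReal.ofReal (pexpDensity p (x + t)) := by
  have hm : ∀ t : ℝ, MeasurableSet {x : ℝ | |x - t| ≤ s} := fun t =>
    measurableSet_le (by fun_prop) measurable_const
  have hm0 : MeasurableSet {x : ℝ | |x| ≤ s} := by simpa using hm 0
  rw [pexpMeasure, withDensity_apply _ (hm t), ← lintegral_indicator (hm t),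
    ← lintegral_indicator hm0, ← lintegral_add_right_eq_self _ t]
  refine lintegral_congr fun x => ?_
  simp [indicator]

lemma exp_mul_pexpMeasure_le {p : ℝ} (hp : p ∈ Set.Icc (1 : ℝ) 2) (h s : ℝ) :
    ENNReal.ofReal (Real.exp (-|h| ^ p)) * pexpMeasure p {x | |x| ≤ s} ≤
      pexpMeasure p {x | |x - h| ≤ s} := by
  have hm0 : MeasurableSet {x : ℝ | |x| ≤ s} := measurableSet_le (by fun_prop) measurable_const
  have hmeas : ∀ t, Measurable fun x => ENNReal.ofReal (pexpDensity p (x + t)) := fun t =>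
    (measurable_ofReal_pexpDensity p).comp (measurable_add_const t)
  have hsymm : ∫⁻ x in {x | |x| ≤ s}, ENNReal.ofReal (pexpDensity p (x + -h)) =
      ∫⁻ x in {x | |x| ≤ s}, ENNReal.ofReal (pexpDensity p (x + h)) := by
    rw [← lintegral_indicator hm0, ← lintegral_indicator hm0, ← lintegral_neg_eq_self]
    refine lintegral_congr fun x => ?_
    simp only [indicator, mem_ofPred_eq, abs_neg]
    rw [← pexpDensity_neg p (-x + -h), neg_add, neg_neg, neg_neg]
  have h2 : 2 * (ENNReal.ofReal (Real.exp (-|h| ^ p)) * pexpMeasure p {x | |x| ≤ s}) ≤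
      2 * pexpMeasure p {x | |x - h| ≤ s} := by
    have e0 := pexpMeasure_abs_sub_eq p 0 s
    simp only [sub_zero, add_zero] at e0
    rw [pexpMeasure_abs_sub_eq p h s, two_mul (∫⁻ x in _, _)]
    nth_rw 2 [← hsymm]
    rw [← lintegral_add_left (hmeas h), e0,
      ← lintegral_const_mul _ (measurable_ofReal_pexpDensity p),
      ← lintegral_const_mul _ ((measurable_ofReal_pexpDensity p).const_mul _)]
    refine lintegral_mono fun x => ?_
    dsimp only
    rw [← ENNReal.ofReal_add (pexpDensity_pos hp.1 _).le (pexpDensity_pos hp.1 _).le,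
      ← ENNReal.ofReal_mul (Real.exp_pos _).le,
      show (2 : ENNReal) = ENNReal.ofReal 2 by simp, ← ENNReal.ofReal_mul (by norm_num)]
    exact ENNReal.ofReal_le_ofReal (two_mul_exp_mul_pexpDensity_le hp x h)
  exact (ENNReal.mul_le_mul_iff_right (by simp) (by simp)).mp h2

lemma ofReal_mul_le_pexpMeasure {p : ℝ} (hp : 1 ≤ p) {a : ℝ} (ha : a ≤ 1) :
    ENNReal.ofReal (2 * pexpDensity p 1 * a) ≤ pexpMeasure p {x | |x| ≤ a} := by
  have hI : {x : ℝ | |x| ≤ a} = Icc (-a) a := by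
    ext x
    simp only [mem_ofPred_eq, abs_le, mem_Icc]
  have hm0 : MeasurableSet {x : ℝ | |x| ≤ a} := measurableSet_le (by fun_prop) measurable_const
  rw [pexpMeasure, withDensity_apply _ hm0]
  calc ENNReal.ofReal (2 * pexpDensity p 1 * a)
      = ∫⁻ _ in {x : ℝ | |x| ≤ a}, ENNReal.ofReal (pexpDensity p 1) := by
        rw [setLIntegral_const, hI, Real.volume_Icc, ← ENNReal.ofReal_mul (pexpDensity_pos hp 1).le]
        congr 1
        ring
    _ ≤ _ := by
        refine setLIntegral_mono' hm0 fun x hx => ENNReal.ofReal_le_ofReal (pexpDensity_anti hp ?_)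
        rw [abs_one]
        exact le_trans hx ha

lemma pexpMeasure_abs_le_lt_one {p : ℝ} (hp : 1 ≤ p) (a : ℝ) :
    pexpMeasure p {x | |x| ≤ a} < 1 := by
  have := isProbabilityMeasure_pexpMeasure hp
  have hm0 : MeasurableSet {x : ℝ | |x| ≤ a} := measurableSet_le (by fun_prop) measurable_const
  refine lt_of_le_of_ne prob_le_one fun h => ?_
  have h1 : pexpMeasure p (Ioi a) = 0 :=
    measure_mono_null (fun x (hx : a < x) => not_le.mpr (hx.trans_le (le_abs_self x)))
      ((prob_compl_eq_zero_iff hm0).mpr h)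
  rw [pexpMeasure, withDensity_apply_eq_zero (measurable_ofReal_pexpDensity p)] at h1
  have h2 : {x | ENNReal.ofReal (pexpDensity p x) ≠ 0} = univ := by
    ext x
    simp [pexpDensity_pos hp x]
  rw [h2, univ_inter, Real.volume_Ioi] at h1
  exact ENNReal.top_ne_zero h1

lemma exists_lintegral_exp_neg_mul_sq_le {p : ℝ} (hp : 1 ≤ p) {δ : ℝ} (hδ : 0 < δ) :
    ∃ l : ℝ, 1 ≤ l ∧ ∫⁻ x, ENNReal.ofReal (Real.exp (-l * x ^ 2)) ∂pexpMeasure p ≤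
      ENNReal.ofReal δ := by
  have hC := pexpDensity_pos hp 0
  refine ⟨max 1 (Real.pi * (pexpDensity p 0 / δ) ^ 2), le_max_left _ _, ?_⟩
  set l := max 1 (Real.pi * (pexpDensity p 0 / δ) ^ 2)
  have hl : 0 < l := lt_of_lt_of_le one_pos (le_max_left _ _)
  rw [pexpMeasure, lintegral_withDensity_eq_lintegral_mul _ (measurable_ofReal_pexpDensity p)
    (by fun_prop)]
  calc _ ≤ ∫⁻ x, ENNReal.ofReal (pexpDensity p 0 * Real.exp (-l * x ^ 2)) := by
        refine lintegral_mono fun x => ?_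
        rw [Pi.mul_apply, ← ENNReal.ofReal_mul (pexpDensity_pos hp x).le]
        refine ENNReal.ofReal_le_ofReal ?_
        gcongr
        exact pexpDensity_anti hp (by simp)
    _ = ENNReal.ofReal (pexpDensity p 0 * √(Real.pi / l)) := by
        rw [← ofReal_integral_eq_lintegral_ofReal ((integrable_exp_neg_mul_sq hl).const_mul _)
          (Eventually.of_forall fun x => by positivity), integral_const_mul, integral_gaussian]
    _ ≤ _ := by
        refine ENNReal.ofReal_le_ofReal ?_
        rw [← le_div_iff₀' hC, Real.sqrt_le_left (by positivity), div_le_iff₀ hl]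
        have : Real.pi * (pexpDensity p 0 / δ) ^ 2 ≤ l := le_max_right _ _
        calc Real.pi = (δ / pexpDensity p 0) ^ 2 * (Real.pi * (pexpDensity p 0 / δ) ^ 2) := by
              field_simp
          _ ≤ _ := by gcongr

lemma prod_measure_add_le {m₁ m₂ k₁ k₂ : Measure ℝ} [SFinite m₁] [SFinite m₂] [SFinite k₁]
    [SFinite k₂] {a b : ENNReal} (hm : ∀ r, m₁ (Iic r) ≤ a * m₂ (Iic r))
    (hk : ∀ r, k₁ (Iic r) ≤ b * k₂ (Iic r)) (r : ℝ) :
    (m₁.prod k₁) {q | q.1 + q.2 ≤ r} ≤ a * b * (m₂.prod k₂) {q | q.1 + q.2 ≤ r} := by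
  have hs : MeasurableSet {q : ℝ × ℝ | q.1 + q.2 ≤ r} :=
    measurableSet_le (by fun_prop) measurable_const
  have e1 : ∀ x : ℝ, Prod.mk x ⁻¹' {q : ℝ × ℝ | q.1 + q.2 ≤ r} = Iic (r - x) := by
    intro x
    ext y
    simp [le_sub_iff_add_le']
  have e2 : ∀ y : ℝ, (fun x => (x, y)) ⁻¹' {q : ℝ × ℝ | q.1 + q.2 ≤ r} = Iic (r - y) := by
    intro x
    ext y
    simp [le_sub_iff_add_le]
  calc (m₁.prod k₁) {q | q.1 + q.2 ≤ r} = ∫⁻ x, k₁ (Iic (r - x)) ∂m₁ := by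
        rw [Measure.prod_apply hs]
        simp_rw [e1]
    _ ≤ ∫⁻ x, b * k₂ (Iic (r - x)) ∂m₁ := lintegral_mono fun x => hk _
    _ = b * (m₁.prod k₂) {q | q.1 + q.2 ≤ r} := by
        have := measurable_measure_prodMk_left (ν := k₂) hs
        simp_rw [e1] at this
        rw [lintegral_const_mul _ this, Measure.prod_apply hs]
        simp_rw [e1]
    _ = b * ∫⁻ y, m₁ (Iic (r - y)) ∂k₂ := by
        rw [Measure.prod_apply_symm hs]
        simp_rw [e2]
    _ ≤ b * ∫⁻ y, a * m₂ (Iic (r - y)) ∂k₂ := by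
        gcongr
        exact hm _
    _ = a * b * (m₂.prod k₂) {q | q.1 + q.2 ≤ r} := by
        have := measurable_measure_prodMk_right (μ := m₂) hs
        simp_rw [e2] at this
        rw [lintegral_const_mul _ this, Measure.prod_apply_symm hs]
        simp_rw [e2]
        ring

lemma measure_sum_succ_eq {Ω : Type*} [MeasurableSpace Ω] {P : Measure Ω} {X : ℕ → Ω → ℝ}
    (hX : ∀ i, Measurable (X i)) (hI : iIndepFun X P) (N : ℕ) (r : ℝ) :
    P {ω | ∑ i ∈ Finset.range (N + 1), X i ω ≤ r} =
      ((P.map fun ω => ∑ i ∈ Finset.range N, X i ω).prod (P.map (X N))) {q | q.1 + q.2 ≤ r} := by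
  have := hI.isProbabilityMeasure
  have hs : MeasurableSet {q : ℝ × ℝ | q.1 + q.2 ≤ r} :=
    measurableSet_le (by fun_prop) measurable_const
  have hsum : Measurable fun ω => ∑ i ∈ Finset.range N, X i ω := by fun_prop
  have hind : IndepFun (fun ω => ∑ i ∈ Finset.range N, X i ω) (X N) P := by
    have := hI.indepFun_sum_range_succ hX N
    convert this using 1
    ext ω
    simp
  rw [← (indepFun_iff_map_prod_eq_prod_map_map hsum.aemeasurable (hX N).aemeasurable).mp hind,
    Measure.map_apply (hsum.prodMk (hX N)) hs]
  simp [Finset.sum_range_succ]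

/-- Comparison of distribution functions is inherited by sums of independent variables. -/
lemma measure_sum_le_of_measure_le {Ω : Type*} [MeasurableSpace Ω] {P : Measure Ω}
    {X Y : ℕ → Ω → ℝ} (hX : ∀ i, Measurable (X i)) (hY : ∀ i, Measurable (Y i))
    (hXI : iIndepFun X P) (hYI : iIndepFun Y P) {c : ℕ → ENNReal}
    (hc : ∀ i r, P {ω | X i ω ≤ r} ≤ c i * P {ω | Y i ω ≤ r}) (N : ℕ) (r : ℝ) :
    P {ω | ∑ i ∈ Finset.range N, X i ω ≤ r} ≤
      (∏ i ∈ Finset.range N, c i) * P {ω | ∑ i ∈ Finset.range N, Y i ω ≤ r} := by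
  have := hXI.isProbabilityMeasure
  induction N generalizing r with
  | zero => simp
  | succ N ih =>
    rw [measure_sum_succ_eq hX hXI, measure_sum_succ_eq hY hYI, Finset.prod_range_succ]
    have hsX : Measurable fun ω => ∑ i ∈ Finset.range N, X i ω := by fun_prop
    have hsY : Measurable fun ω => ∑ i ∈ Finset.range N, Y i ω := by fun_prop
    have := Measure.isProbabilityMeasure_map (μ := P) hsX.aemeasurable
    have := Measure.isProbabilityMeasure_map (μ := P) hsY.aemeasurable
    have := Measure.isProbabilityMeasure_map (μ := P) (hX N).aemeasurable
    have := Measure.isProbabilityMeasure_map (μ := P) (hY N).aemeasurable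
    refine prod_measure_add_le (fun s => ?_) (fun s => ?_) r
    · rw [Measure.map_apply hsX measurableSet_Iic, Measure.map_apply hsY measurableSet_Iic]
      exact ih s
    · rw [Measure.map_apply (hX N) measurableSet_Iic, Measure.map_apply (hY N) measurableSet_Iic]
      exact hc N s

/-- The standard deviation factor `τ ℓ^{−1/2−α}` of the coordinate `ℓ = i + 1`. -/
def coordScale (α τ : ℝ) (i : ℕ) : ℝ := τ * idx i ^ (-(1 / 2 : ℝ) - α)

lemma idx_pos (i : ℕ) : 0 < idx i := by
  unfold idx
  positivity

lemma coordScale_pos {τ : ℝ} (hτ : 0 < τ) (α : ℝ) (i : ℕ) : 0 < coordScale α τ i :=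
  mul_pos hτ (Real.rpow_pos_of_pos (idx_pos i) _)

lemma coordScale_sq {τ : ℝ} (α : ℝ) (i : ℕ) :
    coordScale α τ i ^ 2 = τ ^ 2 * idx i ^ (-(1 + 2 * α)) := by
  rw [coordScale, mul_pow, ← Real.rpow_natCast (idx i ^ _), ← Real.rpow_mul (idx_pos i).le]
  congr 2
  push_cast
  ring

section Prior

variable {p α τ : ℝ} {μ : Measure (ℕ → ℝ)}

lemma isProbabilityMeasure_coordLaw (hp : 1 ≤ p) (i : ℕ) :
    IsProbabilityMeasure (coordLaw p α τ i) := by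
  have := isProbabilityMeasure_pexpMeasure hp
  exact Measure.isProbabilityMeasure_map (by fun_prop)

lemma IsPexpPrior.eq_infinitePi (hμ : IsPexpPrior p α τ μ) (hp : 1 ≤ p) :
    μ = Measure.infinitePi (coordLaw p α τ) := by
  have := fun i => isProbabilityMeasure_coordLaw (α := α) (τ := τ) hp i
  exact hμ.2.unique (Measure.isProjectiveLimit_infinitePi _)

lemma IsPexpPrior.iIndepFun_comp (hμ : IsPexpPrior p α τ μ) (hp : 1 ≤ p) {g : ℕ → ℝ → ℝ}
    (hg : ∀ i, Measurable (g i)) : iIndepFun (fun i (θ : ℕ → ℝ) => g i (θ i)) μ := by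
  have := fun i => isProbabilityMeasure_coordLaw (α := α) (τ := τ) hp i
  rw [hμ.eq_infinitePi hp]
  exact iIndepFun_infinitePi hg

lemma IsPexpPrior.map_eval (hμ : IsPexpPrior p α τ μ) (hp : 1 ≤ p) (i : ℕ) :
    μ.map (fun θ => θ i) = (pexpMeasure p).map fun x => coordScale α τ i * x := by
  have := fun i => isProbabilityMeasure_coordLaw (α := α) (τ := τ) hp i
  rw [hμ.eq_infinitePi hp]
  exact Measure.infinitePi_map_eval _ i

lemma IsPexpPrior.measure_abs_sub_le (hμ : IsPexpPrior p α τ μ) (hp : 1 ≤ p) (hτ : 0 < τ)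
    (i : ℕ) (t s : ℝ) :
    μ {θ | |θ i - t| ≤ s} =
      pexpMeasure p {x | |x - t / coordScale α τ i| ≤ s / coordScale α τ i} := by
  have hm : MeasurableSet {x : ℝ | |x - t| ≤ s} := measurableSet_le (by fun_prop) measurable_const
  have hσ := coordScale_pos hτ α i
  have h := congrArg (fun m => m {x : ℝ | |x - t| ≤ s}) (hμ.map_eval hp i)
  rw [Measure.map_apply (by fun_prop) hm, Measure.map_apply (by fun_prop) hm] at h
  refine h.trans (congrArg _ ?_)
  ext x
  simp only [mem_preimage, mem_ofPred_eq]
  rw [le_div_iff₀ hσ, ← abs_of_pos hσ, ← abs_mul, abs_of_pos hσ, sub_mul,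
    div_mul_cancel₀ _ hσ.ne', mul_comm x]

lemma IsPexpPrior.lintegral_comp_eval (hμ : IsPexpPrior p α τ μ) (hp : 1 ≤ p) (i : ℕ)
    {g : ℝ → ENNReal} (hg : Measurable g) :
    ∫⁻ θ, g (θ i) ∂μ = ∫⁻ x, g (coordScale α τ i * x) ∂pexpMeasure p := by
  rw [← lintegral_map (μ := pexpMeasure p) hg (by fun_prop : Measurable fun x => coordScale α τ i * x),
    ← hμ.map_eval hp i, lintegral_map hg (by fun_prop)]

lemma sq_le_setOf_eq {t r : ℝ} (hr : 0 ≤ r) (i : ℕ) :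
    {θ : ℕ → ℝ | (θ i - t) ^ 2 ≤ r} = {θ | |θ i - t| ≤ √r} := by
  ext θ
  rw [mem_ofPred_eq, mem_ofPred_eq, Real.le_sqrt (abs_nonneg _) hr, sq_abs]

lemma sq_le_setOf_eq_empty {t r : ℝ} (hr : r < 0) (i : ℕ) :
    {θ : ℕ → ℝ | (θ i - t) ^ 2 ≤ r} = ∅ := by
  ext θ
  simp only [mem_ofPred_eq, mem_empty_iff_false, iff_false, not_le]
  exact hr.trans_le (sq_nonneg _)

lemma IsPexpPrior.measure_coord_anderson (hμ : IsPexpPrior p α τ μ) (hp : 1 ≤ p) (hτ : 0 < τ)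
    (i : ℕ) (t r : ℝ) : μ {θ | (θ i - t) ^ 2 ≤ r} ≤ μ {θ | (θ i) ^ 2 ≤ r} := by
  rcases lt_or_ge r 0 with hr | hr
  · simp [sq_le_setOf_eq_empty hr]
  have h0 := sq_le_setOf_eq (t := 0) hr i
  have h1 := hμ.measure_abs_sub_le hp hτ i 0 √r
  simp only [sub_zero, zero_div] at h0 h1
  rw [sq_le_setOf_eq hr, h0, h1, hμ.measure_abs_sub_le hp hτ]
  exact pexpMeasure_abs_sub_le hp _ _

lemma IsPexpPrior.measure_coord_shift (hμ : IsPexpPrior p α τ μ) (hp : p ∈ Set.Icc (1 : ℝ) 2)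
    (hτ : 0 < τ) (i : ℕ) (t r : ℝ) :
    μ {θ | (θ i) ^ 2 ≤ r} ≤ ENNReal.ofReal (Real.exp (|t / coordScale α τ i| ^ p)) *
      μ {θ | (θ i - t) ^ 2 ≤ r} := by
  rcases lt_or_ge r 0 with hr | hr
  · have := sq_le_setOf_eq_empty (t := 0) hr i
    simp only [sub_zero] at this
    simp [this]
  have h0 := sq_le_setOf_eq (t := 0) hr i
  have h1 := hμ.measure_abs_sub_le hp.1 hτ i 0 √r
  simp only [sub_zero, zero_div] at h0 h1
  rw [sq_le_setOf_eq hr, h0, h1, hμ.measure_abs_sub_le hp.1 hτ]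
  refine le_trans ?_ (mul_le_mul_right (exp_mul_pexpMeasure_le hp _ _) _)
  rw [← mul_assoc, ← ENNReal.ofReal_mul (Real.exp_pos _).le, ← Real.exp_add]
  simp

lemma measurableSet_partialBall (t : ℕ → ℝ) (N : ℕ) (r : ℝ) :
    MeasurableSet {θ : ℕ → ℝ | ∑ i ∈ Finset.range N, (θ i - t i) ^ 2 ≤ r} :=
  measurableSet_le (by fun_prop) measurable_const

lemma IsPexpPrior.measure_partialBall_anderson (hμ : IsPexpPrior p α τ μ) (hp : 1 ≤ p)
    (hτ : 0 < τ) (t : ℕ → ℝ) (N : ℕ) (r : ℝ) :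
    μ {θ | ∑ i ∈ Finset.range N, (θ i - t i) ^ 2 ≤ r} ≤
      μ {θ | ∑ i ∈ Finset.range N, (θ i) ^ 2 ≤ r} := by
  have := measure_sum_le_of_measure_le (P := μ) (X := fun i θ => (θ i - t i) ^ 2)
    (Y := fun i θ => (θ i) ^ 2) (fun i => by fun_prop) (fun i => by fun_prop)
    (hμ.iIndepFun_comp hp (g := fun i x => (x - t i) ^ 2) (by fun_prop))
    (hμ.iIndepFun_comp hp (g := fun i x => x ^ 2) (by fun_prop)) (c := fun _ => 1)
    (fun i r => by simpa using hμ.measure_coord_anderson hp hτ i (t i) r) N r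
  simpa using this

lemma abs_div_coordScale_rpow (hτ : 0 < τ) (t : ℕ → ℝ) (i : ℕ) :
    |t i / coordScale α τ i| ^ p = τ ^ (-p) * zSummand p α t i := by
  have hi := idx_pos i
  rw [abs_div, abs_of_pos (coordScale_pos hτ α i), Real.div_rpow (abs_nonneg _)
    (coordScale_pos hτ α i).le, coordScale, Real.mul_rpow hτ.le (by positivity),
    ← Real.rpow_mul hi.le, zSummand, Real.rpow_neg hτ.le, div_eq_mul_inv, mul_inv,
    ← Real.rpow_neg hi.le]
  have : -((-(1 / 2) - α) * p) = p / 2 + α * p := by ring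
  rw [this]
  ring

lemma zSummand_nonneg (t : ℕ → ℝ) (i : ℕ) : 0 ≤ zSummand p α t i := by
  have := idx_pos i
  unfold zSummand
  positivity

lemma IsPexpPrior.measure_partialBall_shift (hμ : IsPexpPrior p α τ μ)
    (hp : p ∈ Set.Icc (1 : ℝ) 2) (hτ : 0 < τ) (t : ℕ → ℝ) (ht : Summable (zSummand p α t))
    (N : ℕ) (r : ℝ) :
    μ {θ | ∑ i ∈ Finset.range N, (θ i) ^ 2 ≤ r} ≤ ENNReal.ofReal (Real.exp (zNormP p α τ t)) *
      μ {θ | ∑ i ∈ Finset.range N, (θ i - t i) ^ 2 ≤ r} := by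
  have := measure_sum_le_of_measure_le (P := μ) (Y := fun i θ => (θ i - t i) ^ 2)
    (X := fun i θ => (θ i) ^ 2) (fun i => by fun_prop) (fun i => by fun_prop)
    (hμ.iIndepFun_comp hp.1 (g := fun i x => x ^ 2) (by fun_prop))
    (hμ.iIndepFun_comp hp.1 (g := fun i x => (x - t i) ^ 2) (by fun_prop))
    (fun i r => hμ.measure_coord_shift hp hτ i (t i) r) N r
  refine this.trans ?_
  gcongr
  rw [← ENNReal.ofReal_prod_of_nonneg fun i _ => (Real.exp_pos _).le, ← Real.exp_sum]
  refine ENNReal.ofReal_le_ofReal (Real.exp_le_exp.mpr ?_)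
  simp_rw [abs_div_coordScale_rpow hτ]
  rw [← Finset.mul_sum, zNormP]
  gcongr
  exact ht.sum_le_tsum _ fun i _ => zSummand_nonneg t i

lemma setOf_l2_le_eq_iInter (t : ℕ → ℝ) {r : ℝ} (hr : 0 ≤ r) :
    {θ : ℕ → ℝ | Summable (fun i => (θ i - t i) ^ 2) ∧ l2norm (fun i => θ i - t i) ≤ r} =
      ⋂ N, {θ | ∑ i ∈ Finset.range N, (θ i - t i) ^ 2 ≤ r ^ 2} := by
  ext θ
  simp only [mem_ofPred_eq, mem_iInter, l2norm]
  constructor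
  · rintro ⟨hs, h⟩ N
    exact (hs.sum_le_tsum _ fun i _ => sq_nonneg _).trans ((Real.sqrt_le_left hr).mp h)
  · intro h
    exact ⟨summable_of_sum_range_le (fun i => sq_nonneg _) h,
      (Real.sqrt_le_left hr).mpr (Real.tsum_le_of_sum_range_le (fun i => sq_nonneg _) h)⟩

lemma l2Ball_eq_iInter {r : ℝ} (hr : 0 ≤ r) :
    l2Ball r = ⋂ N, {θ : ℕ → ℝ | ∑ i ∈ Finset.range N, (θ i) ^ 2 ≤ r ^ 2} := by
  simpa [l2Ball] using setOf_l2_le_eq_iInter 0 hr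

lemma tendsto_measure_partialBall [IsFiniteMeasure μ] (t : ℕ → ℝ) (r : ℝ) :
    Tendsto (fun N => μ {θ | ∑ i ∈ Finset.range N, (θ i - t i) ^ 2 ≤ r}) atTop
      (nhds (μ (⋂ N, {θ | ∑ i ∈ Finset.range N, (θ i - t i) ^ 2 ≤ r}))) := by
  refine tendsto_measure_iInter_atTop
    (fun N => (measurableSet_partialBall t N r).nullMeasurableSet) ?_ ⟨0, measure_ne_top _ _⟩
  intro M N hMN θ hθ
  simp only [mem_ofPred_eq] at hθ ⊢
  refine le_trans ?_ hθ
  exact Finset.sum_le_sum_of_subset_of_nonneg (Finset.range_mono hMN) fun i _ _ => sq_nonneg _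

lemma IsPexpPrior.measure_ball_anderson (hμ : IsPexpPrior p α τ μ) (hp : 1 ≤ p)
    (hτ : 0 < τ) (t : ℕ → ℝ) {r : ℝ} (hr : 0 ≤ r) :
    μ {θ | Summable (fun i => (θ i - t i) ^ 2) ∧ l2norm (fun i => θ i - t i) ≤ r} ≤
      μ (l2Ball r) := by
  have := hμ.1
  rw [setOf_l2_le_eq_iInter t hr, l2Ball_eq_iInter hr]
  have h0 := tendsto_measure_partialBall (μ := μ) 0 (r ^ 2)
  simp only [Pi.zero_apply, sub_zero] at h0
  refine ge_of_tendsto' h0 fun N => ?_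
  exact (measure_mono (iInter_subset _ N)).trans (hμ.measure_partialBall_anderson hp hτ t N _)

lemma IsPexpPrior.measure_ball_shift (hμ : IsPexpPrior p α τ μ) (hp : p ∈ Set.Icc (1 : ℝ) 2)
    (hτ : 0 < τ) (t : ℕ → ℝ) (ht : Summable (zSummand p α t)) {r : ℝ} (hr : 0 ≤ r) :
    μ (l2Ball r) ≤ ENNReal.ofReal (Real.exp (zNormP p α τ t)) *
      μ {θ | Summable (fun i => (θ i - t i) ^ 2) ∧ l2norm (fun i => θ i - t i) ≤ r} := by
  have := hμ.1
  rw [setOf_l2_le_eq_iInter t hr, l2Ball_eq_iInter hr]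
  have h0 := ENNReal.Tendsto.const_mul (a := ENNReal.ofReal (Real.exp (zNormP p α τ t)))
    (tendsto_measure_partialBall (μ := μ) t (r ^ 2)) (Or.inr ENNReal.ofReal_ne_top)
  refine ge_of_tendsto' h0 fun N => ?_
  exact (measure_mono (iInter_subset _ N)).trans (hμ.measure_partialBall_shift hp hτ t ht N _)

lemma IsPexpPrior.lintegral_sq_eval (hμ : IsPexpPrior p α τ μ) (hp : 1 ≤ p) (i : ℕ) :
    ∫⁻ θ, ENNReal.ofReal ((θ i) ^ 2) ∂μ = ENNReal.ofReal (coordScale α τ i ^ 2) *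
      ∫⁻ x, ENNReal.ofReal (x ^ 2) ∂pexpMeasure p := by
  rw [hμ.lintegral_comp_eval hp i (g := fun x => ENNReal.ofReal (x ^ 2)) (by fun_prop),
    ← lintegral_const_mul _ (by fun_prop)]
  refine lintegral_congr fun x => ?_
  rw [mul_pow, ENNReal.ofReal_mul (sq_nonneg _)]

lemma summable_coordScale_sq (hα : 0 < α) : Summable fun i => coordScale α τ i ^ 2 := by
  simp_rw [coordScale_sq]
  refine Summable.mul_left _ ?_
  have := (Real.summable_nat_rpow (p := -(1 + 2 * α))).mpr (by linarith)
  simpa [idx] using (summable_nat_add_iff 1).mpr this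

lemma IsPexpPrior.ae_summable_sq (hμ : IsPexpPrior p α τ μ) (hp : 1 ≤ p) (hα : 0 < α) :
    ∀ᵐ θ ∂μ, Summable fun i => (θ i) ^ 2 := by
  have h : ∫⁻ θ, ∑' i, ENNReal.ofReal ((θ i) ^ 2) ∂μ ≠ ⊤ := by
    rw [lintegral_tsum fun i => Measurable.aemeasurable (by fun_prop)]
    simp_rw [hμ.lintegral_sq_eval hp]
    rw [ENNReal.tsum_mul_right]
    refine ENNReal.mul_ne_top ?_ (lintegral_sq_pexpMeasure_lt_top hp).ne
    rw [← ENNReal.ofReal_tsum_of_nonneg (fun i => sq_nonneg _) (summable_coordScale_sq hα)]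
    exact ENNReal.ofReal_ne_top
  filter_upwards [ae_lt_top (by fun_prop) h] with θ hθ
  have := ENNReal.summable_toReal hθ.ne
  simpa [ENNReal.toReal_ofReal (sq_nonneg _)] using this

end Prior

lemma rpow_neg_succ_le_sub {a : ℝ} (ha : 0 < a) {x : ℝ} (hx : 0 < x) :
    (x + 1) ^ (-(1 + a)) ≤ (x ^ (-a) - (x + 1) ^ (-a)) / a := by
  rw [le_div_iff₀ ha]
  have h1 : 0 < x + 1 := by linarith
  have e : x ^ (-a) = (x + 1) ^ (-a) * (x / (x + 1)) ^ (-a) := by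
    rw [← Real.mul_rpow h1.le (by positivity)]
    congr 1
    field_simp
  have hlog : Real.log (x / (x + 1)) ≤ -(1 / (x + 1)) := by
    refine (Real.log_le_sub_one_of_pos (by positivity)).trans (le_of_eq ?_)
    field_simp
    ring
  have h2 : 1 + a / (x + 1) ≤ (x / (x + 1)) ^ (-a) := by
    rw [Real.rpow_def_of_pos (by positivity)]
    have h3 : a / (x + 1) ≤ Real.log (x / (x + 1)) * -a := by
      have := mul_le_mul_of_nonneg_left hlog ha.le
      have e3 : a * -(1 / (x + 1)) = -(a / (x + 1)) := by ring
      linarith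
    linarith [Real.add_one_le_exp (Real.log (x / (x + 1)) * -a)]
  rw [e, neg_add, Real.rpow_add h1, Real.rpow_neg_one]
  have h4 : 0 < (x + 1) ^ (-a) := by positivity
  have := mul_le_mul_of_nonneg_left h2 h4.le
  rw [mul_add, mul_one] at this
  calc (x + 1)⁻¹ * (x + 1) ^ (-a) * a = (x + 1) ^ (-a) * (a / (x + 1)) := by ring
    _ ≤ _ := by linarith

lemma sum_Ico_idx_rpow_le {a : ℝ} (ha : 0 < a) {n : ℕ} (hn : 1 ≤ n) {N : ℕ} (hN : n ≤ N) :
    ∑ i ∈ Finset.Ico n N, idx i ^ (-(1 + a)) ≤ (n : ℝ) ^ (-a) / a := by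
  have h : ∑ i ∈ Finset.Ico n N, idx i ^ (-(1 + a)) ≤
      ((n : ℝ) ^ (-a) - (N : ℝ) ^ (-a)) / a := by
    induction N, hN using Nat.le_induction with
    | base => simp
    | succ N hN ih =>
      rw [Finset.sum_Ico_succ_top hN]
      have := rpow_neg_succ_le_sub ha (x := N) (by exact_mod_cast hn.trans hN)
      push_cast
      unfold idx at ih ⊢
      rw [sub_div] at *
      linarith
  refine h.trans ?_
  gcongr
  linarith [Real.rpow_nonneg (Nat.cast_nonneg N : (0 : ℝ) ≤ N) (-a)]

lemma exp_neg_le_prod_idx_div {n : ℕ} (hn : 1 ≤ n) :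
    Real.exp (-n) ≤ ∏ i ∈ Finset.range n, idx i / n := by
  have h0 : (0 : ℝ) < n := by exact_mod_cast hn
  have h1 : ∏ i ∈ Finset.range n, idx i = (n.factorial : ℝ) := by
    rw [← Finset.prod_range_add_one_eq_factorial]
    push_cast
    rfl
  rw [Finset.prod_div_distrib, h1, Finset.prod_const, Finset.card_range, Real.exp_neg,
    inv_le_comm₀ (Real.exp_pos _) (by positivity), inv_div]
  exact Real.pow_div_factorial_le_exp _ h0.le n

section SmallBall

variable {p α τ : ℝ} {μ : Measure (ℕ → ℝ)}

lemma IsPexpPrior.measure_partialBall_le_exp (hμ : IsPexpPrior p α τ μ) (hp : 1 ≤ p)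
    {l : ℝ} (hl : 0 < l)
    (hlp : ∫⁻ x, ENNReal.ofReal (Real.exp (-l * x ^ 2)) ∂pexpMeasure p ≤
      ENNReal.ofReal (Real.exp (-2))) {n : ℕ} {b r : ℝ} (hb : 0 < b)
    (hbσ : ∀ i < n, b ≤ coordScale α τ i ^ 2) (hr : l * r ≤ n * b) :
    μ.real {θ | ∑ i ∈ Finset.range n, (θ i) ^ 2 ≤ r} ≤ Real.exp (-n) := by
  have := hμ.1
  have hind := hμ.iIndepFun_comp hp (g := fun i x => x ^ 2 / b) (by fun_prop)
  have hmeas : ∀ i : ℕ, Measurable fun θ : ℕ → ℝ => θ i ^ 2 / b := fun i => by fun_prop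
  have hcoord : ∀ i < n, mgf (fun θ : ℕ → ℝ => θ i ^ 2 / b) μ (-l) ≤ Real.exp (-2) := by
    intro i hi
    rw [mgf, integral_eq_lintegral_of_nonneg_ae (Eventually.of_forall fun _ => (Real.exp_pos _).le)
      (Measurable.aestronglyMeasurable (by fun_prop))]
    refine ENNReal.toReal_le_of_le_ofReal (Real.exp_pos _).le (le_trans ?_ hlp)
    rw [hμ.lintegral_comp_eval hp i (g := fun x => ENNReal.ofReal (Real.exp (-l * (x ^ 2 / b))))
      (by fun_prop)]
    refine lintegral_mono fun x => ENNReal.ofReal_le_ofReal (Real.exp_le_exp.mpr ?_)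
    rw [neg_mul, neg_mul, neg_le_neg_iff]
    refine mul_le_mul_of_nonneg_left ?_ hl.le
    rw [le_div_iff₀ hb, mul_pow, mul_comm]
    exact mul_le_mul_of_nonneg_right (hbσ i hi) (sq_nonneg _)
  have hint : Integrable (fun θ : ℕ → ℝ =>
      Real.exp (-l * (∑ i ∈ Finset.range n, fun θ : ℕ → ℝ => θ i ^ 2 / b) θ)) μ := by
    refine Integrable.of_bound (C := 1) ?_ (Eventually.of_forall fun θ => ?_)
    · simp only [Finset.sum_apply]
      exact Measurable.aestronglyMeasurable (by fun_prop)
    · rw [Real.norm_eq_abs, abs_of_pos (Real.exp_pos _), Real.exp_le_one_iff, Finset.sum_apply]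
      have : 0 ≤ ∑ i ∈ Finset.range n, θ i ^ 2 / b := Finset.sum_nonneg fun i _ => by positivity
      nlinarith
  have hch := measure_le_le_exp_mul_mgf (r / b) (by linarith : -l ≤ 0) hint
  rw [hind.mgf_sum hmeas] at hch
  have hset : {θ : ℕ → ℝ | (∑ i ∈ Finset.range n, fun θ : ℕ → ℝ => θ i ^ 2 / b) θ ≤ r / b} =
      {θ | ∑ i ∈ Finset.range n, (θ i) ^ 2 ≤ r} := by
    ext θ
    simp only [mem_ofPred_eq, Finset.sum_apply]
    rw [← Finset.sum_div, div_le_div_iff_of_pos_right hb]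
  rw [hset] at hch
  refine hch.trans ?_
  calc _ ≤ Real.exp n * ∏ i ∈ Finset.range n, Real.exp (-2) := by
        refine mul_le_mul (Real.exp_le_exp.mpr ?_)
          (Finset.prod_le_prod (fun i _ => mgf_nonneg)
            fun i hi => hcoord i (Finset.mem_range.mp hi))
          (Finset.prod_nonneg fun i _ => mgf_nonneg) (Real.exp_pos _).le
        rw [neg_neg, ← mul_div_assoc, div_le_iff₀ hb]
        exact hr
    _ = _ := by
        rw [← Real.exp_sum, ← Real.exp_add]
        simp only [Finset.sum_const, Finset.card_range, nsmul_eq_mul]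
        congr 1
        ring

lemma measureReal_l2Ball_le [IsFiniteMeasure μ] {r : ℝ} (hr : 0 ≤ r) (n : ℕ) :
    μ.real (l2Ball r) ≤ μ.real {θ | ∑ i ∈ Finset.range n, (θ i) ^ 2 ≤ r ^ 2} := by
  rw [l2Ball_eq_iInter hr]
  exact measureReal_mono (iInter_subset _ n)

lemma idx_le {i n : ℕ} (h : i < n) : idx i ≤ n := by
  unfold idx
  exact_mod_cast h

lemma IsPexpPrior.measure_l2Ball_le_exp (hμ : IsPexpPrior p α τ μ) (hp : 1 ≤ p) (hα : 0 < α)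
    (hτ : 0 < τ) {l : ℝ} (hl : 0 < l)
    (hlp : ∫⁻ x, ENNReal.ofReal (Real.exp (-l * x ^ 2)) ∂pexpMeasure p ≤
      ENNReal.ofReal (Real.exp (-2))) {n : ℕ} (hn : 1 ≤ n) {r : ℝ} (hr : 0 ≤ r)
    (h : l * (r / τ) ^ 2 * (n : ℝ) ^ (2 * α) ≤ 1) :
    μ.real (l2Ball r) ≤ Real.exp (-n) := by
  have := hμ.1
  have h0 : (0 : ℝ) < n := by exact_mod_cast hn
  refine (measureReal_l2Ball_le hr n).trans
    (hμ.measure_partialBall_le_exp hp hl hlp (b := τ ^ 2 * (n : ℝ) ^ (-(1 + 2 * α)))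
      (by positivity) (fun i hi => ?_) ?_)
  · rw [coordScale_sq]
    gcongr τ ^ 2 * ?_
    exact Real.rpow_le_rpow_of_nonpos (idx_pos i) (idx_le hi) (by linarith)
  · have e : (n : ℝ) * (τ ^ 2 * (n : ℝ) ^ (-(1 + 2 * α))) = τ ^ 2 * ((n : ℝ) ^ (2 * α))⁻¹ := by
      rw [neg_add, Real.rpow_add h0, Real.rpow_neg_one, Real.rpow_neg h0.le]
      field_simp
    have hpos : 0 < (n : ℝ) ^ (2 * α) := by positivity
    rw [e, ← div_eq_mul_inv, le_div_iff₀ hpos]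
    calc l * r ^ 2 * (n : ℝ) ^ (2 * α) = τ ^ 2 * (l * (r / τ) ^ 2 * (n : ℝ) ^ (2 * α)) := by
          field_simp
      _ ≤ τ ^ 2 * 1 := by gcongr
      _ = τ ^ 2 := mul_one _

lemma IsPexpPrior.measure_l2Ball_le_pexpMeasure (hμ : IsPexpPrior p α τ μ) (hp : 1 ≤ p)
    (hτ : 0 < τ) {r M : ℝ} (hr : 0 ≤ r) (h : r / τ ≤ M) :
    μ.real (l2Ball r) ≤ (pexpMeasure p).real {x | |x| ≤ M} := by
  have := hμ.1
  have := isProbabilityMeasure_pexpMeasure hp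
  refine (measureReal_l2Ball_le hr 1).trans ?_
  have e := sq_le_setOf_eq (t := 0) (sq_nonneg r) 0
  have e1 := hμ.measure_abs_sub_le hp hτ 0 0 r
  have e2 : coordScale α τ 0 = τ := by simp [coordScale, idx]
  simp only [sub_zero, zero_div, Real.sqrt_sq hr, e2] at e e1
  simp only [Finset.range_one, Finset.sum_singleton]
  rw [e, Measure.real, e1]
  exact measureReal_mono fun x (hx : |x| ≤ r / τ) => hx.trans h

lemma measure_box_inter_sum_eq {Ω : Type*} [MeasurableSpace Ω] {P : Measure Ω} {X : ℕ → Ω → ℝ}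
    (hX : ∀ i, Measurable (X i)) (hI : iIndepFun X P) (A : ℕ → Set ℝ)
    (hA : ∀ i, MeasurableSet (A i)) (n N : ℕ) (r : ℝ) :
    P ({ω | ∀ i ∈ Finset.range n, X i ω ∈ A i} ∩ {ω | ∑ i ∈ Finset.Ico n N, X i ω ≤ r}) =
      (∏ i ∈ Finset.range n, P {ω | X i ω ∈ A i}) * P {ω | ∑ i ∈ Finset.Ico n N, X i ω ≤ r} := by
  have hdisj : Disjoint (Finset.range n) (Finset.Ico n N) := by
    rw [Finset.range_eq_Ico]
    exact Finset.Ico_disjoint_Ico_consecutive 0 n N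
  have h := (hI.indepFun_finset _ _ hdisj hX).measure_inter_preimage_eq_mul
    (univ.pi fun i : Finset.range n => A i)
    {y : Finset.Ico n N → ℝ | ∑ i, y i ≤ r} (MeasurableSet.univ_pi fun i => hA i)
    (measurableSet_le (by fun_prop) measurable_const)
  have e1 : (fun ω (i : Finset.range n) => X i ω) ⁻¹' (univ.pi fun i : Finset.range n => A i) =
      {ω | ∀ i ∈ Finset.range n, X i ω ∈ A i} := by
    ext ω
    simp
  have e2 : (fun ω (i : Finset.Ico n N) => X i ω) ⁻¹' {y : Finset.Ico n N → ℝ | ∑ i, y i ≤ r} =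
      {ω | ∑ i ∈ Finset.Ico n N, X i ω ≤ r} := by
    ext ω
    simp only [mem_preimage, mem_ofPred_eq]
    rw [Finset.sum_coe_sort (Finset.Ico n N) fun i => X i ω]
  rw [e1, e2] at h
  rw [h]
  congr 1
  refine Eq.trans (congrArg P ?_)
    (hI.measure_inter_preimage_eq_mul (Finset.range n) (sets := A) fun i _ => hA i)
  ext ω
  simp

lemma IsPexpPrior.half_le_measure_tail (hμ : IsPexpPrior p α τ μ) (hp : 1 ≤ p) (hα : 0 < α)
    (hτ : 0 < τ) {n N : ℕ} (hn : 1 ≤ n) (hN : n ≤ N) {r : ℝ} (hr : 0 < r)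
    (h : 2 * (∫⁻ x, ENNReal.ofReal (x ^ 2) ∂pexpMeasure p).toReal / α ≤
      (r / τ) ^ 2 * (n : ℝ) ^ (2 * α)) :
    ENNReal.ofReal (1 / 2) ≤ μ {θ | ∑ i ∈ Finset.Ico n N, (θ i) ^ 2 ≤ r ^ 2 / 2} := by
  have := hμ.1
  have h0 : (0 : ℝ) < n := by exact_mod_cast hn
  set m := (∫⁻ x, ENNReal.ofReal (x ^ 2) ∂pexpMeasure p).toReal with hm
  have hm0 : 0 ≤ m := ENNReal.toReal_nonneg
  have hmI : ∫⁻ x, ENNReal.ofReal (x ^ 2) ∂pexpMeasure p = ENNReal.ofReal m :=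
    (ENNReal.ofReal_toReal (lintegral_sq_pexpMeasure_lt_top hp).ne).symm
  have hmeas : MeasurableSet {θ : ℕ → ℝ | ∑ i ∈ Finset.Ico n N, (θ i) ^ 2 ≤ r ^ 2 / 2} :=
    measurableSet_le (by fun_prop) measurable_const
  have hE : ∫⁻ θ, ENNReal.ofReal (∑ i ∈ Finset.Ico n N, (θ i) ^ 2) ∂μ ≤
      ENNReal.ofReal (r ^ 2 / 4) := by
    have e : ∀ θ : ℕ → ℝ, ENNReal.ofReal (∑ i ∈ Finset.Ico n N, (θ i) ^ 2) =
        ∑ i ∈ Finset.Ico n N, ENNReal.ofReal ((θ i) ^ 2) := fun θ =>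
      ENNReal.ofReal_sum_of_nonneg fun i _ => sq_nonneg _
    simp_rw [e]
    rw [lintegral_finsetSum _ fun i _ => by fun_prop]
    simp_rw [hμ.lintegral_sq_eval hp]
    rw [← Finset.sum_mul, ← ENNReal.ofReal_sum_of_nonneg fun i _ => sq_nonneg _, hmI,
      ← ENNReal.ofReal_mul (Finset.sum_nonneg fun i _ => sq_nonneg _)]
    refine ENNReal.ofReal_le_ofReal ?_
    simp_rw [coordScale_sq]
    rw [← Finset.mul_sum]
    have hs := sum_Ico_idx_rpow_le (a := 2 * α) (by positivity) hn hN
    calc τ ^ 2 * (∑ i ∈ Finset.Ico n N, idx i ^ (-(1 + 2 * α))) * m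
        ≤ τ ^ 2 * ((n : ℝ) ^ (-(2 * α)) / (2 * α)) * m := by gcongr
      _ = τ ^ 2 * (n : ℝ) ^ (-(2 * α)) / 4 * (2 * m / α) := by
          field_simp
          ring
      _ ≤ τ ^ 2 * (n : ℝ) ^ (-(2 * α)) / 4 * ((r / τ) ^ 2 * (n : ℝ) ^ (2 * α)) := by gcongr
      _ = r ^ 2 / 4 := by
          rw [Real.rpow_neg h0.le]
          field_simp
  have hc : μ {θ | ∑ i ∈ Finset.Ico n N, (θ i) ^ 2 ≤ r ^ 2 / 2}ᶜ ≤ ENNReal.ofReal (1 / 2) := by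
    calc _ ≤ μ {θ | ENNReal.ofReal (r ^ 2 / 2) ≤
          ENNReal.ofReal (∑ i ∈ Finset.Ico n N, (θ i) ^ 2)} := by
          refine measure_mono fun θ hθ => ?_
          simp only [mem_compl_iff, mem_ofPred_eq, not_le] at hθ ⊢
          exact ENNReal.ofReal_le_ofReal hθ.le
      _ ≤ _ := meas_ge_le_lintegral_div (Measurable.aemeasurable (by fun_prop))
          (by simp only [ne_eq, ENNReal.ofReal_eq_zero, not_le]; positivity) ENNReal.ofReal_ne_top
      _ ≤ ENNReal.ofReal (r ^ 2 / 4) / ENNReal.ofReal (r ^ 2 / 2) := by gcongr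
      _ = _ := by
          rw [← ENNReal.ofReal_div_of_pos (by positivity)]
          congr 1
          field_simp
          norm_num
  have hadd := prob_add_prob_compl (μ := μ) hmeas
  have h1 : (1 : ENNReal) = ENNReal.ofReal (1 / 2) + ENNReal.ofReal (1 / 2) := by
    rw [← ENNReal.ofReal_add (by norm_num) (by norm_num)]
    norm_num
  by_contra hlt
  rw [not_le] at hlt
  have := ENNReal.add_lt_add_of_lt_of_le (ne_top_of_le_ne_top ENNReal.ofReal_ne_top hc) hlt hc
  rw [hadd, ← h1] at this
  exact lt_irrefl _ this

lemma IsPexpPrior.le_measure_coord (hμ : IsPexpPrior p α τ μ) (hp : 1 ≤ p) (hα : 0 < α)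
    (hτ : 0 < τ) {i n : ℕ} (hi : i < n) {r : ℝ} (hr : 0 < r)
    (h : 1 ≤ (r / τ) ^ 2 * (n : ℝ) ^ (2 * α)) :
    ENNReal.ofReal (pexpDensity p 1 * (idx i / n) ^ (1 / 2 + α)) ≤
      μ {θ | (θ i) ^ 2 ∈ Iic (r ^ 2 / (2 * n))} := by
  have h0 : (0 : ℝ) < n := by exact_mod_cast (Nat.zero_le i).trans_lt hi
  have hidx := idx_pos i
  have e := sq_le_setOf_eq (t := 0) (show 0 ≤ r ^ 2 / (2 * n) by positivity) i
  have e1 := hμ.measure_abs_sub_le hp hτ i 0 (√(r ^ 2 / (2 * n)))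
  have := isProbabilityMeasure_pexpMeasure hp
  simp only [sub_zero, zero_div] at e e1
  simp only [mem_Iic]
  rw [e, e1]
  set u := (idx i / n) ^ (1 / 2 + α) with hu
  have hu0 : 0 < u := by positivity
  have hu1 : u ≤ 1 := Real.rpow_le_one (by positivity)
    ((div_le_one h0).mpr (idx_le hi)) (by positivity)
  have hσ := coordScale_pos hτ α i
  have hle : u / 2 ≤ √(r ^ 2 / (2 * n)) / coordScale α τ i := by
    rw [le_div_iff₀ hσ]
    refine Real.le_sqrt_of_sq_le ?_
    have hu2 : u ^ 2 = (idx i) ^ (1 + 2 * α) / ((n : ℝ) * (n : ℝ) ^ (2 * α)) := by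
      rw [hu, ← Real.rpow_natCast, ← Real.rpow_mul (by positivity),
        show (1 / 2 + α) * ((2 : ℕ) : ℝ) = 1 + 2 * α by push_cast; ring,
        Real.div_rpow hidx.le h0.le, Real.rpow_add h0, Real.rpow_one]
    have h2 : 1 ≤ r ^ 2 * (n : ℝ) ^ (2 * α) / τ ^ 2 := by
      calc 1 ≤ _ := h
        _ = _ := by rw [div_pow]; ring
    rw [one_le_div (by positivity)] at h2
    have hI : 0 < idx i ^ (1 + 2 * α) := by positivity
    have hNn : 0 < (n : ℝ) ^ (2 * α) := by positivity
    rw [mul_pow, div_pow, hu2, coordScale_sq, Real.rpow_neg hidx.le]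
    calc _ = τ ^ 2 / (4 * n * (n : ℝ) ^ (2 * α)) := by
          field_simp
          norm_num
      _ ≤ r ^ 2 * (n : ℝ) ^ (2 * α) / (4 * n * (n : ℝ) ^ (2 * α)) := by gcongr
      _ = r ^ 2 / (4 * n) := by field_simp
      _ ≤ r ^ 2 / (2 * n) := by gcongr; norm_num
  refine le_trans ?_ (measure_mono (fun x (hx : |x| ≤ u / 2) => hx.trans hle))
  refine le_trans (le_of_eq ?_) (ofReal_mul_le_pexpMeasure hp (a := u / 2) (by linarith))
  congr 1
  ring

lemma IsPexpPrior.exp_le_measure_l2Ball (hμ : IsPexpPrior p α τ μ) (hp : 1 ≤ p) (hα : 0 < α)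
    (hτ : 0 < τ) {n : ℕ} (hn : 1 ≤ n) {r : ℝ} (hr : 0 < r)
    (h1 : 1 ≤ (r / τ) ^ 2 * (n : ℝ) ^ (2 * α))
    (h2 : 2 * (∫⁻ x, ENNReal.ofReal (x ^ 2) ∂pexpMeasure p).toReal / α ≤
      (r / τ) ^ 2 * (n : ℝ) ^ (2 * α)) :
    Real.exp (-(n * (1 / 2 + α + Real.log 2 + |Real.log (pexpDensity p 1)|))) ≤
      μ.real (l2Ball r) := by
  have := hμ.1
  have h0 : (1 : ℝ) ≤ n := by exact_mod_cast hn
  have hf := pexpDensity_pos hp 1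
  have hprod : Real.exp (-(n * (1 / 2 + α + |Real.log (pexpDensity p 1)|))) ≤
      ∏ i ∈ Finset.range n, (pexpDensity p 1 * (idx i / n) ^ (1 / 2 + α)) := by
    rw [Finset.prod_mul_distrib, Finset.prod_const, Finset.card_range,
      Real.finsetProd_rpow _ _ fun i _ => div_nonneg (idx_pos i).le (by linarith)]
    have hf1 : Real.exp (-|Real.log (pexpDensity p 1)|) ≤ pexpDensity p 1 := by
      rw [← Real.le_log_iff_exp_le hf]
      exact neg_abs_le _
    calc _ = Real.exp (-|Real.log (pexpDensity p 1)|) ^ n * Real.exp (-n) ^ (1 / 2 + α) := by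
          rw [← Real.exp_nat_mul, ← Real.exp_mul, ← Real.exp_add]
          congr 1
          ring
      _ ≤ _ := by
          gcongr
          exact exp_neg_le_prod_idx_div hn
  refine (ENNReal.ofReal_le_iff_le_toReal (measure_ne_top _ _)).mp ?_
  have hlim := tendsto_measure_partialBall (μ := μ) 0 (r ^ 2)
  simp only [Pi.zero_apply, sub_zero] at hlim
  rw [l2Ball_eq_iInter hr.le]
  refine ge_of_tendsto hlim ?_
  filter_upwards [eventually_ge_atTop n] with N hN
  have hind := hμ.iIndepFun_comp hp (g := fun i x => x ^ 2) (by fun_prop)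
  have hbox := measure_box_inter_sum_eq (fun i => by fun_prop) hind
    (fun _ => Iic (r ^ 2 / (2 * n))) (fun _ => measurableSet_Iic) n N (r ^ 2 / 2)
  calc _ ≤ ENNReal.ofReal ((∏ i ∈ Finset.range n, (pexpDensity p 1 * (idx i / n) ^ (1 / 2 + α))) *
        (1 / 2)) := by
        refine ENNReal.ofReal_le_ofReal ?_
        calc _ = Real.exp (-(n * (1 / 2 + α + |Real.log (pexpDensity p 1)|))) *
              Real.exp (-(n * Real.log 2)) := by
              rw [← Real.exp_add]
              congr 1
              ring
          _ ≤ _ := by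
              have hl : 0 ≤ Real.log 2 := Real.log_nonneg (by norm_num)
              have : Real.exp (-(n * Real.log 2)) ≤ 1 / 2 := by
                rw [one_div, Real.exp_neg]
                refine inv_anti₀ (by norm_num) ?_
                rw [← Real.log_le_iff_le_exp (by norm_num)]
                nlinarith
              gcongr
              exact Finset.prod_nonneg fun i _ => by
                have := idx_pos i
                positivity
    _ = (∏ i ∈ Finset.range n, ENNReal.ofReal (pexpDensity p 1 * (idx i / n) ^ (1 / 2 + α))) *
        ENNReal.ofReal (1 / 2) := by
        rw [ENNReal.ofReal_mul', ENNReal.ofReal_prod_of_nonneg]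
        · intro i _
          have := idx_pos i
          positivity
        · norm_num
    _ ≤ _ := by
        gcongr with i hi
        · exact hμ.le_measure_coord hp hα hτ (Finset.mem_range.mp hi) hr h1
        · exact hμ.half_le_measure_tail hp hα hτ hn hN hr h2
    _ = _ := hbox.symm
    _ ≤ _ := by
        refine measure_mono ?_
        rintro θ ⟨hb, ht⟩
        simp only [mem_ofPred_eq, mem_Iic] at hb ht ⊢
        rw [← Finset.sum_range_add_sum_Ico _ hN]
        have := Finset.sum_le_sum hb
        rw [Finset.sum_const, Finset.card_range, nsmul_eq_mul] at this
        have e : (n : ℝ) * (r ^ 2 / (2 * n)) = r ^ 2 / 2 := by field_simp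
        linarith

end SmallBall

lemma div_sq_rpow {D δ α : ℝ} (hD : 0 ≤ D) (hδ : 0 < δ) (hα : 0 < α) :
    (D / δ ^ 2) ^ (1 / (2 * α)) = D ^ (1 / (2 * α)) * δ ^ (-(1 / α)) := by
  rw [Real.div_rpow hD (sq_nonneg _), ← Real.rpow_natCast, ← Real.rpow_mul hδ.le, div_eq_mul_inv,
    ← Real.rpow_neg hδ.le]
  congr 2
  push_cast
  field_simp

lemma sq_mul_div_sq_rpow {D δ α : ℝ} (hD : 0 ≤ D) (hδ : 0 < δ) (hα : 0 < α) :
    δ ^ 2 * ((D / δ ^ 2) ^ (1 / (2 * α))) ^ (2 * α) = D := by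
  rw [← Real.rpow_mul (by positivity), one_div_mul_cancel (by positivity), Real.rpow_one]
  field_simp

section Concentration

variable {p α τ : ℝ} {μ : Measure (ℕ → ℝ)}

lemma zNormP_nonneg (hτ : 0 < τ) (h : ℕ → ℝ) : 0 ≤ zNormP p α τ h :=
  mul_nonneg (Real.rpow_nonneg hτ.le _) (tsum_nonneg fun i => zSummand_nonneg h i)

lemma concFun_zero (hp : p ≠ 0) (hτ : 0 < τ) {r : ℝ} (hr : 0 ≤ r) :
    concFun p α τ μ 0 r = -Real.log (μ.real (l2Ball r)) := by
  have hz : zSummand p α 0 = 0 := by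
    ext i
    simp [zSummand, Real.zero_rpow hp]
  rw [concFun, IsLeast.csInf_eq (a := 0), zero_sub, Measure.real]
  refine ⟨⟨0, ?_, ?_, ?_, ?_⟩, ?_⟩
  · rw [hz]
    exact summable_zero
  · simp [summable_zero]
  · simpa [l2norm] using hr
  · simp [zNormP, hz]
  · rintro c ⟨h, -, -, -, rfl⟩
    exact zNormP_nonneg hτ h

lemma exists_neg_log_measure_l2Ball_le {α₁ M : ℝ} (hp : 1 ≤ p) (hα₁ : 0 < α₁) (α₂ : ℝ) :
    ∃ c, ∀ α ∈ Icc α₁ α₂, ∀ τ : ℝ, 0 < τ → ∀ μ, IsPexpPrior p α τ μ → ∀ r : ℝ, 0 < r → r / τ ≤ M →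
      0 < μ.real (l2Ball r) ∧ -Real.log (μ.real (l2Ball r)) ≤ c * (r / τ) ^ (-(1 / α)) := by
  set m := (∫⁻ x, ENNReal.ofReal (x ^ 2) ∂pexpMeasure p).toReal
  set D := max 1 (max (2 * m / α₁) (M ^ 2))
  have hD1 : 1 ≤ D := le_max_left _ _
  have hDm : 2 * m / α₁ ≤ D := (le_max_left _ _).trans (le_max_right _ _)
  have hDM : M ^ 2 ≤ D := (le_max_right _ _).trans (le_max_right _ _)
  refine ⟨2 * D ^ (1 / (2 * α₁)) * (1 / 2 + α₂ + Real.log 2 + |Real.log (pexpDensity p 1)|),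
    fun α hα τ hτ μ hμ r hr hM => ?_⟩
  have hα0 : 0 < α := hα₁.trans_le hα.1
  set δ := r / τ
  have hδ : 0 < δ := div_pos hr hτ
  set x := (D / δ ^ 2) ^ (1 / (2 * α)) with hx
  have hx1 : 1 ≤ x := by
    refine Real.one_le_rpow ?_ (by positivity)
    rw [one_le_div (by positivity)]
    exact (pow_le_pow_left₀ hδ.le hM 2).trans hDM
  have hn : x ≤ ⌈x⌉₊ := Nat.le_ceil x
  have hn2 : (⌈x⌉₊ : ℝ) ≤ 2 * x := by
    have := Nat.ceil_lt_add_one (zero_le_one.trans hx1)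
    linarith
  have hge : D ≤ δ ^ 2 * (⌈x⌉₊ : ℝ) ^ (2 * α) := by
    rw [← sq_mul_div_sq_rpow (zero_le_one.trans hD1) hδ hα0]
    gcongr
  have hle := hμ.exp_le_measure_l2Ball hp hα0 hτ (Nat.one_le_ceil_iff.mpr (by linarith)) hr
    (hD1.trans hge) (le_trans (div_le_div_of_nonneg_left (by positivity) hα₁ hα.1)
      (hDm.trans hge))
  have hpos := (Real.exp_pos _).trans_le hle
  refine ⟨hpos, ?_⟩
  rw [← Real.le_log_iff_exp_le hpos] at hle
  have hl : 0 ≤ Real.log 2 := Real.log_nonneg (by norm_num)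
  have hDα : D ^ (1 / (2 * α)) ≤ D ^ (1 / (2 * α₁)) := by
    have := hα.1
    gcongr
  have hA : 0 ≤ |Real.log (pexpDensity p 1)| := abs_nonneg _
  have h2 := hα.2
  calc _ ≤ ⌈x⌉₊ * (1 / 2 + α + Real.log 2 + |Real.log (pexpDensity p 1)|) := by linarith
    _ ≤ 2 * x * (1 / 2 + α₂ + Real.log 2 + |Real.log (pexpDensity p 1)|) := by gcongr
    _ = 2 * D ^ (1 / (2 * α)) * (1 / 2 + α₂ + Real.log 2 + |Real.log (pexpDensity p 1)|) *
        δ ^ (-(1 / α)) := by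
        rw [hx, div_sq_rpow (by positivity) hδ hα0]
        ring
    _ ≤ _ := by
        have : 0 ≤ 1 / 2 + α₂ + Real.log 2 + |Real.log (pexpDensity p 1)| := by linarith
        gcongr

lemma exists_le_neg_log_measure_l2Ball {α₁ M : ℝ} (hp : 1 ≤ p) (hα₁ : 0 < α₁) :
    ∃ c, 0 < c ∧ ∀ α, α₁ ≤ α → ∀ τ : ℝ, 0 < τ → ∀ μ, IsPexpPrior p α τ μ → ∀ r : ℝ, 0 < r →
      r / τ ≤ M → 0 < μ.real (l2Ball r) →
        c * (r / τ) ^ (-(1 / α)) ≤ -Real.log (μ.real (l2Ball r)) := by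
  obtain ⟨l, hl1, hl⟩ := exists_lintegral_exp_neg_mul_sq_le hp (Real.exp_pos (-2))
  have hl0 : 0 < l := zero_lt_one.trans_le hl1
  have := isProbabilityMeasure_pexpMeasure hp
  set q := (pexpMeasure p).real {x | |x| ≤ M} with hq
  have hq1 : q < 1 := by
    rw [hq, Measure.real, ← ENNReal.toReal_one,
      ENNReal.toReal_lt_toReal (measure_ne_top _ _) ENNReal.one_ne_top]
    exact pexpMeasure_abs_le_lt_one hp M
  by_cases hq0 : 0 < q
  swap
  · refine ⟨1, one_pos, fun α _ τ hτ μ hμ r hr hM hpos => absurd (hpos.trans_le ?_) hq0⟩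
    exact hμ.measure_l2Ball_le_pexpMeasure hp hτ hr.le hM
  have hc0 : 0 < -Real.log q := neg_pos.mpr (Real.log_neg hq0 hq1)
  refine ⟨min (-Real.log q) (1 / 2) * (1 / l) ^ (1 / (2 * α₁)),
    mul_pos (lt_min hc0 (by norm_num)) (by positivity), fun α hα τ hτ μ hμ r hr hM hpos => ?_⟩
  have hα0 : 0 < α := hα₁.trans_le hα
  set δ := r / τ
  have hδ : 0 < δ := div_pos hr hτ
  set x := ((1 / l) / δ ^ 2) ^ (1 / (2 * α)) with hx
  have hx0 : 0 < x := by positivity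
  have hlx : (1 / l) ^ (1 / (2 * α₁)) * δ ^ (-(1 / α)) ≤ x := by
    rw [hx, div_sq_rpow (by positivity) hδ hα0]
    gcongr ?_ * _
    exact Real.rpow_le_rpow_of_exponent_ge (by positivity) ((div_le_one hl0).mpr hl1) (by gcongr)
  rw [mul_assoc]
  have hmin : 0 ≤ min (-Real.log q) (1 / 2) := (lt_min hc0 (by norm_num)).le
  refine (mul_le_mul_of_nonneg_left hlx hmin).trans ?_
  rcases lt_or_ge x 1 with hx1 | hx1
  · have h1 := Real.log_le_log hpos (hμ.measure_l2Ball_le_pexpMeasure hp hτ hr.le hM)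
    calc _ ≤ min (-Real.log q) (1 / 2) * 1 := by gcongr
      _ ≤ -Real.log q := by
        rw [mul_one]
        exact min_le_left _ _
      _ ≤ _ := neg_le_neg h1
  · have hn : (⌊x⌋₊ : ℝ) ≤ x := Nat.floor_le hx0.le
    have hn1 : 1 ≤ ⌊x⌋₊ := (Nat.one_le_floor_iff x).mpr hx1
    have hn1' : (1 : ℝ) ≤ ⌊x⌋₊ := by exact_mod_cast hn1
    have hn2 := Nat.lt_floor_add_one x
    have hle := hμ.measure_l2Ball_le_exp hp hα0 hτ hl0 hl hn1 hr.le (by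
      rw [mul_assoc]
      calc _ ≤ l * (δ ^ 2 * x ^ (2 * α)) := by gcongr
        _ = 1 := by
          rw [hx, sq_mul_div_sq_rpow (by positivity) hδ hα0]
          field_simp)
    rw [← Real.log_le_iff_le_exp hpos] at hle
    calc _ ≤ 1 / 2 * x := by
          gcongr
          exact min_le_right _ _
      _ ≤ _ := by linarith

lemma exists_concFun_zero_bounds {α₁ : ℝ} (hp : 1 ≤ p) (hα₁ : 0 < α₁) (α₂ M : ℝ) :
    ∃ c, 0 < c ∧ ∀ α ∈ Icc α₁ α₂, ∀ τ : ℝ, 0 < τ → ∀ μ, IsPexpPrior p α τ μ →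
      ∀ r : ℝ, 0 < r → r / τ ≤ M →
        c⁻¹ * (r / τ) ^ (-(1 / α)) ≤ concFun p α τ μ 0 r ∧
          concFun p α τ μ 0 r ≤ c * (r / τ) ^ (-(1 / α)) := by
  obtain ⟨a, ha⟩ := exists_neg_log_measure_l2Ball_le (M := M) hp hα₁ α₂
  obtain ⟨b, hb0, hb⟩ := exists_le_neg_log_measure_l2Ball (M := M) hp hα₁
  refine ⟨max a b⁻¹, lt_max_of_lt_right (by positivity), fun α hα τ hτ μ hμ r hr hM => ?_⟩
  obtain ⟨hpos, hupper⟩ := ha α hα τ hτ μ hμ r hr hM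
  have hlower := hb α hα.1 τ hτ μ hμ r hr hM hpos
  have hδ : 0 < r / τ := div_pos hr hτ
  rw [concFun_zero (by linarith) hτ hr.le]
  constructor
  · refine le_trans ?_ hlower
    gcongr
    exact inv_le_of_inv_le₀ hb0 (le_max_right _ _)
  · refine hupper.trans ?_
    gcongr
    exact le_max_left _ _

end Concentration

lemma summable_sq_sub {f g : ℕ → ℝ} (hf : Summable fun i => f i ^ 2)
    (hg : Summable fun i => g i ^ 2) : Summable fun i => (f i - g i) ^ 2 := by
  refine Summable.of_nonneg_of_le (fun i => sq_nonneg _) (fun i => ?_)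
    ((hf.mul_left 2).add (hg.mul_left 2))
  nlinarith [sq_nonneg (f i + g i)]

lemma l2norm_add_le {f g : ℕ → ℝ} (hf : Summable fun i => f i ^ 2)
    (hg : Summable fun i => g i ^ 2) :
    l2norm (fun i => f i + g i) ≤ l2norm f + l2norm g := by
  have h := Real.Lp_add_le_tsum_of_nonneg (p := 2) one_le_two (fun i => abs_nonneg (f i))
    (fun i => abs_nonneg (g i)) (by simpa using hf) (by simpa using hg)
  simp only [Real.rpow_two, sq_abs, ← Real.sqrt_eq_rpow] at h
  refine le_trans (Real.sqrt_le_sqrt ?_) h.2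
  have hle : ∀ i, (f i + g i) ^ 2 ≤ (|f i| + |g i|) ^ 2 := fun i => by
    rw [← sq_abs (f i + g i)]
    exact pow_le_pow_left₀ (abs_nonneg _) (abs_add_le _ _) 2
  exact Summable.tsum_le_tsum hle (.of_nonneg_of_le (fun i => sq_nonneg _) hle h.1) h.1

lemma exists_summable_zSummand_l2norm_sub_le {p : ℝ} (hp : p ≠ 0) (α : ℝ) {θ : ℕ → ℝ}
    (hθ : Summable fun i => θ i ^ 2) {r : ℝ} (hr : 0 < r) :
    ∃ h : ℕ → ℝ, Summable (zSummand p α h) ∧ Summable (fun i => (h i - θ i) ^ 2) ∧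
      l2norm (fun i => h i - θ i) ≤ r := by
  obtain ⟨N, hN⟩ := ((tendsto_sum_nat_add fun i => θ i ^ 2).eventually_lt_const
    (pow_pos hr 2)).exists
  set h : ℕ → ℝ := fun i => if i < N then θ i else 0
  have hsq : (fun i => (h i - θ i) ^ 2) = fun i => if i < N then 0 else θ i ^ 2 := by
    ext i
    by_cases hi : i < N <;> simp [h, hi]
  have hsum : Summable fun i => (h i - θ i) ^ 2 := by
    rw [hsq]
    refine Summable.of_nonneg_of_le (fun i => ?_) (fun i => ?_) hθ <;>
      by_cases hi : i < N <;> simp [hi, sq_nonneg]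
  refine ⟨h, summable_of_ne_finset_zero (s := Finset.range N) fun i hi => ?_, hsum, ?_⟩
  · simp only [Finset.mem_range] at hi
    simp [zSummand, h, hi, Real.zero_rpow hp]
  · have htail : ∀ i, (h (i + N) - θ (i + N)) ^ 2 = θ (i + N) ^ 2 := by simp [h]
    rw [l2norm, Real.sqrt_le_left hr.le, ← hsum.sum_add_tsum_nat_add N, hsq,
      Finset.sum_eq_zero fun i hi => if_pos (Finset.mem_range.mp hi), zero_add]
    simpa only [htail] using hN.le

section SmallBallEquation

variable {p α τ : ℝ} {μ : Measure (ℕ → ℝ)} {θ : ℕ → ℝ} {r s : ℝ}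

lemma concFun_zero_le_of_exp_neg_le_measure_ball (hμ : IsPexpPrior p α τ μ) (hp : 1 ≤ p)
    (hα : 0 < α) (hτ : 0 < τ) (hθ : Summable fun i => θ i ^ 2) (hr : 0 ≤ r)
    (h : ENNReal.ofReal (Real.exp (-s)) ≤ μ {ϑ | l2norm (fun i => ϑ i - θ i) ≤ r}) :
    concFun p α τ μ 0 r ≤ s := by
  have := hμ.1
  have hle : μ {ϑ | l2norm (fun i => ϑ i - θ i) ≤ r} ≤
      μ {ϑ | Summable (fun i => (ϑ i - θ i) ^ 2) ∧ l2norm (fun i => ϑ i - θ i) ≤ r} := by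
    refine measure_mono_ae ?_
    filter_upwards [hμ.ae_summable_sq hp hα] with ϑ hϑ hball
    exact ⟨summable_sq_sub hϑ hθ, hball⟩
  have hexp : Real.exp (-s) ≤ μ.real (l2Ball r) :=
    (ENNReal.ofReal_le_iff_le_toReal (measure_ne_top _ _)).mp
      (h.trans (hle.trans (hμ.measure_ball_anderson hp hτ θ hr)))
  rw [concFun_zero (by linarith) hτ hr, neg_le,
    Real.le_log_iff_exp_le ((Real.exp_pos _).trans_le hexp)]
  exact hexp

lemma le_concFun_of_measure_ball_le_exp_neg (hμ : IsPexpPrior p α τ μ)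
    (hp : p ∈ Icc (1 : ℝ) 2) (hα : 0 < α) (hτ : 0 < τ) (hθ : Summable fun i => θ i ^ 2)
    (hr : 0 < r)
    (h : μ {ϑ | l2norm (fun i => ϑ i - θ i) ≤ r} ≤ ENNReal.ofReal (Real.exp (-s))) :
    s ≤ concFun p α τ μ θ (r / 2) := by
  have := hμ.1
  have hr2 : 0 < r / 2 := by positivity
  obtain ⟨_, hc⟩ := exists_neg_log_measure_l2Ball_le (M := r / 2 / τ) hp.1 hα α
  have hpos := (hc α ⟨le_rfl, le_rfl⟩ τ hτ μ hμ (r / 2) hr2 le_rfl).1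
  rw [concFun, le_sub_iff_add_le]
  refine le_csInf ?_ ?_
  · obtain ⟨t, ht1, ht2, ht3⟩ :=
      exists_summable_zSummand_l2norm_sub_le (by linarith [hp.1] : p ≠ 0) α hθ hr2
    exact ⟨_, t, ht1, ht2, ht3, rfl⟩
  · rintro _ ⟨t, ht1, ht2, ht3, rfl⟩
    have hsub : {ϑ : ℕ → ℝ | Summable (fun i => (ϑ i - t i) ^ 2) ∧
        l2norm (fun i => ϑ i - t i) ≤ r / 2} ⊆ {ϑ | l2norm (fun i => ϑ i - θ i) ≤ r} := by
      rintro ϑ ⟨hϑ1, hϑ2⟩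
      have := l2norm_add_le hϑ1 ht2
      simp only [sub_add_sub_cancel] at this
      simp only [mem_ofPred_eq]
      linarith
    have hle : μ.real (l2Ball (r / 2)) ≤ Real.exp (zNormP p α τ t - s) := by
      refine ENNReal.toReal_le_of_le_ofReal (Real.exp_pos _).le ?_
      rw [sub_eq_add_neg, Real.exp_add, ENNReal.ofReal_mul (Real.exp_pos _).le]
      refine (hμ.measure_ball_shift hp hτ t ht1 hr2.le).trans ?_
      gcongr
      exact (measure_mono hsub).trans h
    rw [← Real.log_le_iff_le_exp hpos, Measure.real] at hle
    linarith

end SmallBallEquation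

lemma rpow_le_of_mul_rpow_le_mul_sq {α b τ n ε : ℝ} (hα : 0 < α) (hb : 0 ≤ b) (hτ : 0 < τ)
    (hn : 0 < n) (hε : 0 < ε) (h : b * τ ^ (1 / α) * ε ^ (-(1 / α)) ≤ n * ε ^ 2) :
    b ^ (α / (1 + 2 * α)) * τ ^ (1 / (1 + 2 * α)) * n ^ (-(α / (1 + 2 * α))) ≤ ε := by
  have h1 : b * τ ^ (1 / α) * n⁻¹ ≤ ε ^ (2 + 1 / α) := by
    rw [← div_eq_mul_inv, div_le_iff₀ hn, Real.rpow_add hε, Real.rpow_two]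
    rw [Real.rpow_neg hε.le, ← div_eq_mul_inv, div_le_iff₀ (by positivity)] at h
    linarith
  have h2 := Real.rpow_le_rpow (by positivity) h1 (show 0 ≤ α / (1 + 2 * α) by positivity)
  rw [Real.mul_rpow (by positivity) (by positivity), Real.mul_rpow hb (by positivity),
    ← Real.rpow_mul hτ.le, ← Real.rpow_mul hε.le, Real.inv_rpow hn.le, ← Real.rpow_neg hn.le] at h2
  have e1 : 1 / α * (α / (1 + 2 * α)) = 1 / (1 + 2 * α) := by field_simp
  have e2 : (2 + 1 / α) * (α / (1 + 2 * α)) = 1 := by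
    field_simp
    ring
  rwa [e1, e2, Real.rpow_one] at h2

/-- **Lemma 3.2**: the solution `ε_n` of `Π(‖θ−θ₀‖₂ ≤ Kε_n | α,τ) = e^{−nε_n²}` is controlled
by the concentration function, the centered small ball exponent is of order `(Kε/τ)^{−1/α}`
(with constants uniform over `α` in compacts), and consequently `ε_n` admits a polynomial
lower bound whenever `ε_n ≤ C̃τ`. -/
theorem eps_concentration_bounds
    (K : ℝ) (hK : 0 < K)
    (p : ℝ) (hp : p ∈ Set.Icc (1 : ℝ) 2)
    (α τ : ℝ) (hα : 0 < α) (hτ : 0 < τ)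
    (n : ℕ) (hn : 1 ≤ n)
    (θ₀ : ℕ → ℝ) (hθ₀ : Summable fun i => θ₀ i ^ 2)
    -- the p-exponential priors Π(·|α',τ')
    (Prior : ℝ → ℝ → Measure (ℕ → ℝ))
    (hPrior : ∀ α' τ' : ℝ, 0 < α' → 0 < τ' → IsPexpPrior p α' τ' (Prior α' τ'))
    -- ε_n = ε_n(α,τ) : the solution of the small-ball equation
    (epsn : ℝ) (hepsn : 0 < epsn)
    (heq : Prior α τ {θ | l2norm (fun i => θ i - θ₀ i) ≤ K * epsn} =
      ENNReal.ofReal (Real.exp (-(n : ℝ) * epsn ^ 2))) :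
    -- (1): φ₀(Kε_n) ≤ nε_n² ≤ φ_{θ₀}(Kε_n/2)
    (concFun p α τ (Prior α τ) 0 (K * epsn) ≤ (n : ℝ) * epsn ^ 2 ∧
      (n : ℝ) * epsn ^ 2 ≤ concFun p α τ (Prior α τ) θ₀ (K * epsn / 2)) ∧
    -- (2) and (3): small ball bounds with constant c̃₁ = c̃₁(α,C̃), and their consequences
    (∀ Ctil : ℝ, 0 < Ctil →
      ∃ ctil₁ : ℝ, 0 < ctil₁ ∧
        (∀ ε τ' : ℝ, 0 < ε → 0 < τ' → ε ≤ Ctil * τ' →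
          ctil₁⁻¹ * (K * ε / τ') ^ (-(1 / α)) ≤ concFun p α τ' (Prior α τ') 0 (K * ε) ∧
          concFun p α τ' (Prior α τ') 0 (K * ε) ≤ ctil₁ * (K * ε / τ') ^ (-(1 / α))) ∧
        -- (3): consequences for ε_n, provided ε_n ≤ C̃τ
        (epsn ≤ Ctil * τ →
          ctil₁⁻¹ * (K / τ) ^ (-(1 / α)) * epsn ^ (-(1 / α)) ≤ (n : ℝ) * epsn ^ 2 ∧
          (ctil₁⁻¹ * K ^ (-(1 / α))) ^ (α / (1 + 2 * α)) * τ ^ (1 / (1 + 2 * α)) *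
              (n : ℝ) ^ (-(α / (1 + 2 * α))) ≤ epsn)) ∧
    -- (2), uniform version: c̃₁ can be chosen uniformly over α' ∈ [α₁, α₂]
    (∀ α₁ α₂ : ℝ, 0 < α₁ → α₁ < α₂ → ∀ Ctil : ℝ, 0 < Ctil →
      ∃ ctil₁ : ℝ, 0 < ctil₁ ∧
        ∀ α' ∈ Set.Icc α₁ α₂, ∀ ε τ' : ℝ, 0 < ε → 0 < τ' → ε ≤ Ctil * τ' →
          ctil₁⁻¹ * (K * ε / τ') ^ (-(1 / α')) ≤ concFun p α' τ' (Prior α' τ') 0 (K * ε) ∧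
          concFun p α' τ' (Prior α' τ') 0 (K * ε) ≤ ctil₁ * (K * ε / τ') ^ (-(1 / α'))) := by
  have hr : 0 < K * epsn := by positivity
  have hμ := hPrior α τ hα hτ
  rw [neg_mul] at heq
  have hφ := concFun_zero_le_of_exp_neg_le_measure_ball hμ hp.1 hα hτ hθ₀ hr.le heq.ge
  have huniform : ∀ α₁ α₂ : ℝ, 0 < α₁ → ∀ Ctil : ℝ,
      ∃ ctil₁ : ℝ, 0 < ctil₁ ∧
        ∀ α' ∈ Set.Icc α₁ α₂, ∀ ε τ' : ℝ, 0 < ε → 0 < τ' → ε ≤ Ctil * τ' →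
          ctil₁⁻¹ * (K * ε / τ') ^ (-(1 / α')) ≤ concFun p α' τ' (Prior α' τ') 0 (K * ε) ∧
          concFun p α' τ' (Prior α' τ') 0 (K * ε) ≤ ctil₁ * (K * ε / τ') ^ (-(1 / α')) := by
    intro α₁ α₂ hα₁ Ctil
    obtain ⟨c, hc, hbounds⟩ := exists_concFun_zero_bounds hp.1 hα₁ α₂ (K * Ctil)
    refine ⟨c, hc, fun α' hα' ε τ' hε hτ' hle => hbounds α' hα' τ' hτ' _
      (hPrior α' τ' (hα₁.trans_le hα'.1) hτ') _ (by positivity) ?_⟩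
    rw [div_le_iff₀ hτ', mul_assoc]
    gcongr
  refine ⟨⟨hφ, le_concFun_of_measure_ball_le_exp_neg hμ hp hα hτ hθ₀ hr heq.le⟩, ?_,
    fun α₁ α₂ hα₁ _ Ctil _ => huniform α₁ α₂ hα₁ Ctil⟩
  intro Ctil _
  obtain ⟨c, hc, hbounds⟩ := huniform α α hα Ctil
  refine ⟨c, hc, hbounds α ⟨le_rfl, le_rfl⟩, fun hle => ?_⟩
  have hlower : c⁻¹ * (K / τ) ^ (-(1 / α)) * epsn ^ (-(1 / α)) ≤ (n : ℝ) * epsn ^ 2 := by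
    refine le_trans (le_of_eq ?_) ((hbounds α ⟨le_rfl, le_rfl⟩ epsn τ hepsn hτ hle).1.trans hφ)
    rw [mul_assoc, ← Real.mul_rpow (by positivity) hepsn.le, div_mul_eq_mul_div]
  refine ⟨hlower, rpow_le_of_mul_rpow_le_mul_sq hα (by positivity) hτ
    (by exact_mod_cast hn) hepsn ?_⟩
  rwa [Real.div_rpow hK.le hτ.le, Real.rpow_neg hτ.le, div_inv_eq_mul, ← mul_assoc] at hlower
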